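/- arXiv:math/0507256 — 2 statements merged into one kernel-verified Lean document; each statement's English description precedes it below -/
import Mathlib

section
/- Let V be a rational space with a rational scalar product Q. There exists a unique family of maps μ_W, indexed by the rational quotient spaces W of V, such that: (a) μ_W maps pointed rational affine cones in W to meromorphic functions with rational coefficients defined near 0 in W*; (b) μ_{0}({0}) = 1; (c) for every pointed rational affine cone a in W, S(a) = Σ_{f ∈ F(a)} μ_{W/lin(f)}(t(a,f)) · I(f), the sum being over all faces f of a, where μ_{W/lin(f)}(t(a,f)), a priori a function on (W/lin(f))* = lin(f)^⊥ ⊂ W*, is regarded as a function on W* via Q-orthogonal projection. -/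
open MeasureTheory Filter Topology Set
open scoped RealInnerProductSpace Pointwise BigOperators

noncomputable section

/-- the ambient rational vector space: `ℝ^d` with the standard inner product, which is used
to identify `V` with its dual space `V^*`. -/
abbrev Vd (d : ℕ) := EuclideanSpace ℝ (Fin d)

variable {d : ℕ}

/-- the duality pairing `⟨ξ, x⟩` between `V^*` and `V`, realized by the standard inner
product of `ℝ^d`. -/
def pairE {d : ℕ} (ξ x : Vd d) : ℝ := @inner ℝ _ _ ξ x

/-- `Λ` is a lattice of its span: it is generated by finitely many `ℝ`-independent vectors. -/
def IsLatticeSub (Λ : AddSubgroup (Vd d)) : Prop :=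
  ∃ (k : ℕ) (v : Fin k → Vd d), LinearIndependent ℝ v ∧
    Λ = AddSubgroup.closure (Set.range v)

/-- `Λ` is a full-rank lattice in `ℝ^d`. -/
def IsFullLattice (Λ : AddSubgroup (Vd d)) : Prop :=
  IsLatticeSub Λ ∧ Submodule.span ℝ (Λ : Set (Vd d)) = ⊤

/-- `x` is a rational point with respect to the lattice `Λ`. -/
def IsRatPoint (Λ : AddSubgroup (Vd d)) (x : Vd d) : Prop :=
  ∃ q : ℤ, q ≠ 0 ∧ (q : ℝ) • x ∈ Λ

/-- viewing `φ ∈ V` as a linear functional via the standard pairing, it takes integer values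
on `Λ`, i.e. it belongs to the dual lattice. -/
def IsDualIntegral (Λ : AddSubgroup (Vd d)) (φ : Vd d) : Prop :=
  ∀ x ∈ Λ, ∃ n : ℤ, (pairE (φ) (x)) = (n : ℝ)

/-- a rational polyhedron (inside the span of `Λ`): a finite intersection of half-spaces
bounded by rational affine hyperplanes. -/
def IsRatPolyhedron (Λ : AddSubgroup (Vd d)) (P : Set (Vd d)) : Prop :=
  ∃ (n : ℕ) (φ : Fin n → Vd d) (c : Fin n → ℚ),
    (∀ i, IsDualIntegral Λ (φ i)) ∧
    P = {x | x ∈ Submodule.span ℝ (Λ : Set (Vd d)) ∧ ∀ i, (pairE (φ i) x) ≤ (c i : ℝ)}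

/-- the set `P` contains a straight (affine) line. -/
def ContainsLine (P : Set (Vd d)) : Prop :=
  ∃ x u : Vd d, u ≠ 0 ∧ ∀ t : ℝ, x + t • u ∈ P

/-- equality of meromorphic-type functions near `0`: they agree near `0` outside a closed
set with empty interior (the polar set). -/
def MeroEqAt0 (f g : Vd d → ℝ) : Prop :=
  ∃ Z : Set (Vd d), IsClosed Z ∧ interior Z = ∅ ∧
    ∀ᶠ ξ in 𝓝 (0 : Vd d), ξ ∉ Z → f ξ = g ξ

/-- `g` is analytic at `0` and its Taylor coefficients are rational with respect to an
integral basis (i.e. the coefficients take rational values on dual-lattice vectors). -/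
def HasRatSeriesAt0 (Λ : AddSubgroup (Vd d)) (g : Vd d → ℝ) : Prop :=
  ∃ p : FormalMultilinearSeries ℝ (Vd d) ℝ, HasFPowerSeriesAt g p 0 ∧
    ∀ (n : ℕ) (w : Fin n → Vd d), (∀ i, IsDualIntegral Λ (w i)) →
      ∃ q : ℚ, (p n) w = (q : ℝ)

/-- `f` is meromorphic near `0` with rational Taylor coefficients: near `0` it is a quotient
of two analytic functions with rational Taylor coefficients. -/
def RatMeromorphicAt0 (Λ : AddSubgroup (Vd d)) (f : Vd d → ℝ) : Prop :=
  ∃ g h : Vd d → ℝ, HasRatSeriesAt0 Λ g ∧ HasRatSeriesAt0 Λ h ∧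
    (¬ ∀ᶠ ξ in 𝓝 (0 : Vd d), h ξ = 0) ∧
    (∀ᶠ ξ in 𝓝 (0 : Vd d), h ξ ≠ 0 → f ξ * h ξ = g ξ)

/-- `m` is the canonical Lebesgue measure carried by the rational affine subspace `A`,
normalized so that a fundamental parallelepiped of the lattice `Λ ∩ lin(A)` has volume `1`:
it is the image of the standard Lebesgue measure under a `ℤ`-basis parametrization. -/
def IsCanonicalMeasure (Λ : AddSubgroup (Vd d)) (A : Set (Vd d)) (m : Measure (Vd d)) : Prop :=
  ∃ (k : ℕ) (x₀ : Vd d) (v : Fin k → Vd d),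
    x₀ ∈ A ∧ (∀ i, v i ∈ Λ) ∧ LinearIndependent ℝ v ∧
    A = {x | ∃ t : Fin k → ℝ, x = x₀ + ∑ i, t i • v i} ∧
    (∀ y ∈ Λ, y ∈ Submodule.span ℝ (Set.range v) →
      ∃ c : Fin k → ℤ, y = ∑ i, (c i : ℝ) • v i) ∧
    m = Measure.map (fun t : Fin k → ℝ => x₀ + ∑ i, t i • v i) volume

/-- the characterizing properties of the map `I`: it sends rational polyhedra to meromorphic
functions with rational coefficients, vanishes on polyhedra containing lines, and is given by
`∫_P e^{⟨ξ,x⟩} dm_{<P>}(x)` wherever this integral converges. -/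
def IsIMap (Λ : AddSubgroup (Vd d)) (I : Set (Vd d) → Vd d → ℝ) : Prop :=
  (∀ P, IsRatPolyhedron Λ P → RatMeromorphicAt0 Λ (I P)) ∧
  (∀ P, IsRatPolyhedron Λ P → ContainsLine P → ∀ ξ, I P ξ = 0) ∧
  (∀ P, IsRatPolyhedron Λ P → ∀ m : Measure (Vd d),
    IsCanonicalMeasure Λ ((affineSpan ℝ P : AffineSubspace ℝ (Vd d)) : Set (Vd d)) m →
    ∀ ξ : Vd d, IntegrableOn (fun x => Real.exp (pairE (ξ) (x))) P m →
      I P ξ = ∫ x in P, Real.exp (pairE (ξ) (x)) ∂m)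

/-- the characterizing properties of the map `S`: it sends rational polyhedra to meromorphic
functions with rational coefficients, vanishes on polyhedra containing lines, and is given by
`∑_{x ∈ P ∩ Λ} e^{⟨ξ,x⟩}` wherever this sum converges absolutely. -/
def IsSMap (Λ : AddSubgroup (Vd d)) (S : Set (Vd d) → Vd d → ℝ) : Prop :=
  (∀ P, IsRatPolyhedron Λ P → RatMeromorphicAt0 Λ (S P)) ∧
  (∀ P, IsRatPolyhedron Λ P → ContainsLine P → ∀ ξ, S P ξ = 0) ∧
  (∀ P, IsRatPolyhedron Λ P → ∀ ξ : Vd d,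
    Summable (fun x : ↥(P ∩ (Λ : Set (Vd d))) => Real.exp (pairE ξ (x : Vd d))) →
      S P ξ = ∑' x : ↥(P ∩ (Λ : Set (Vd d))), Real.exp (pairE ξ (x : Vd d)))

/-- `F` is a (nonempty, exposed) face of the convex set `P`. -/
def IsFaceOf (P F : Set (Vd d)) : Prop :=
  F.Nonempty ∧ ∃ φ : Vd d, F = {x ∈ P | ∀ y ∈ P, (pairE (φ) (y)) ≤ (pairE (φ) (x))}

/-- `v` is a vertex of `P`. -/
def IsVertexOf (P : Set (Vd d)) (v : Vd d) : Prop := IsFaceOf P {v}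

/-- the cone of feasible directions of `P` along the face `F` (computed at a point of the
relative interior of `F`). -/
def feasibleCone (P F : Set (Vd d)) : Set (Vd d) :=
  {u | ∃ x ∈ intrinsicInterior ℝ F, ∃ ε : ℝ, 0 < ε ∧ ∀ t : ℝ, 0 < t → t ≤ ε → x + t • u ∈ P}

/-- the supporting cone `<F> + c(P,F)` of `P` along its face `F`. -/
def suppCone (P F : Set (Vd d)) : Set (Vd d) :=
  {z | ∃ a ∈ (affineSpan ℝ F : Set (Vd d)), ∃ u ∈ feasibleCone P F, z = a + u}

/-- the recession cone (cone of directions) of a convex set. -/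
def recCone (P : Set (Vd d)) : Set (Vd d) :=
  {u | ∀ x ∈ P, ∀ t : ℝ, 0 ≤ t → x + t • u ∈ P}

/-- a rational affine cone with respect to the lattice `Λ`: a rational translate of a cone
generated by finitely many lattice vectors. -/
def IsRatAffineCone (Λ : AddSubgroup (Vd d)) (a : Set (Vd d)) : Prop :=
  ∃ (s : Vd d) (n : ℕ) (v : Fin n → Vd d), IsRatPoint Λ s ∧ (∀ i, v i ∈ Λ) ∧
    a = {x | ∃ t : Fin n → ℝ, (∀ i, 0 ≤ t i) ∧ x = s + ∑ i, t i • v i}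

/-- a rational (convex polyhedral) cone with vertex at the origin. -/
def IsRatCone (Λ : AddSubgroup (Vd d)) (c : Set (Vd d)) : Prop :=
  ∃ (n : ℕ) (v : Fin n → Vd d), (∀ i, v i ∈ Λ) ∧
    c = {x | ∃ t : Fin n → ℝ, (∀ i, 0 ≤ t i) ∧ x = ∑ i, t i • v i}

/-- `Q` is a rational scalar product: a symmetric positive definite bilinear form taking
rational values on lattice vectors. -/
def IsRatInner (Λ : AddSubgroup (Vd d)) (Q : Vd d →ₗ[ℝ] Vd d →ₗ[ℝ] ℝ) : Prop :=
  (∀ x y, Q x y = Q y x) ∧ (∀ x : Vd d, x ≠ 0 → 0 < Q x x) ∧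
  (∀ x ∈ Λ, ∀ y ∈ Λ, ∃ q : ℚ, Q x y = (q : ℝ))

/-- `π` realizes the quotient map `V → V/L` as the `Q`-orthogonal projection onto the
`Q`-orthogonal complement of `L`. -/
def IsQCoproj (Q : Vd d →ₗ[ℝ] Vd d →ₗ[ℝ] ℝ) (L : Submodule ℝ (Vd d))
    (π : Vd d →ₗ[ℝ] Vd d) : Prop :=
  (∀ x, x - π x ∈ L) ∧ (∀ x : Vd d, ∀ y ∈ L, Q (π x) y = 0)

/-- `Λ'` is the lattice of a rational quotient space of `(V, Λ)`, realized inside `V` via the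
`Q`-orthogonal projection along a rational subspace. -/
def IsQuotLattice (Q : Vd d →ₗ[ℝ] Vd d →ₗ[ℝ] ℝ) (Λ Λ' : AddSubgroup (Vd d)) : Prop :=
  ∃ (L : Submodule ℝ (Vd d)) (π : Vd d →ₗ[ℝ] Vd d),
    Submodule.span ℝ ((L : Set (Vd d)) ∩ (Λ : Set (Vd d))) = L ∧
    IsQCoproj Q L π ∧ Λ' = AddSubgroup.map π.toAddMonoidHom Λ

/-- a family of maps `I` indexed by the rational quotient spaces of `(V,Λ)`, each member
satisfying the characterizing properties of the integral generating function. -/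
def IsIFamily (Q : Vd d →ₗ[ℝ] Vd d →ₗ[ℝ] ℝ) (Λ : AddSubgroup (Vd d))
    (I : AddSubgroup (Vd d) → Set (Vd d) → Vd d → ℝ) : Prop :=
  ∀ Λ', IsQuotLattice Q Λ Λ' → IsIMap Λ' (I Λ')

/-- a family of maps `S` indexed by the rational quotient spaces of `(V,Λ)`, each member
satisfying the characterizing properties of the lattice-point generating function. -/
def IsSFamily (Q : Vd d →ₗ[ℝ] Vd d →ₗ[ℝ] ℝ) (Λ : AddSubgroup (Vd d))
    (S : AddSubgroup (Vd d) → Set (Vd d) → Vd d → ℝ) : Prop :=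
  ∀ Λ', IsQuotLattice Q Λ Λ' → IsSMap Λ' (S Λ')

/-- the defining properties (a),(b),(c) of the family `μ` of Berline--Vergne:
each `μ(a)` is meromorphic with rational coefficients near `0`, `μ_{0}({0}) = 1`, and for
every pointed rational affine cone `a` in a rational quotient `W` of `V` one has
`S(a) = ∑_{f ∈ F(a)} μ(t(a,f)) I(f)`, where the transverse cone `t(a,f)` is realized inside
`V` by the `Q`-orthogonal projection `π F` along `lin(f)`, and functions on quotient duals
are extended by `Q`-orthogonal projection. -/
def IsMuCore (Λ : AddSubgroup (Vd d)) (Q : Vd d →ₗ[ℝ] Vd d →ₗ[ℝ] ℝ)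
    (I S μ : AddSubgroup (Vd d) → Set (Vd d) → Vd d → ℝ) : Prop :=
  (∀ Λ', IsQuotLattice Q Λ Λ' → ∀ a, IsRatAffineCone Λ' a → ¬ ContainsLine a →
      RatMeromorphicAt0 Λ' (μ Λ' a)) ∧
  (∀ ξ, μ ⊥ ({0} : Set (Vd d)) ξ = 1) ∧
  (∀ Λ', IsQuotLattice Q Λ Λ' → ∀ a, IsRatAffineCone Λ' a → ¬ ContainsLine a →
    ∀ π : Set (Vd d) → (Vd d →ₗ[ℝ] Vd d),
      (∀ F, IsFaceOf a F → IsQCoproj Q (affineSpan ℝ F).direction (π F)) →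
      MeroEqAt0 (S Λ' a)
        (fun ξ => ∑ᶠ F ∈ {F | IsFaceOf a F},
          μ (AddSubgroup.map (π F).toAddMonoidHom Λ') ((π F) '' suppCone a F) ξ
            * I Λ' F ξ))

/-- the family `μ`, extended by `μ(a) = 0` on cones containing a straight line. -/
def IsMuFamily (Λ : AddSubgroup (Vd d)) (Q : Vd d →ₗ[ℝ] Vd d →ₗ[ℝ] ℝ)
    (I S μ : AddSubgroup (Vd d) → Set (Vd d) → Vd d → ℝ) : Prop :=
  IsMuCore Λ Q I S μ ∧
  (∀ Λ', IsQuotLattice Q Λ Λ' → ∀ a, IsRatAffineCone Λ' a → ContainsLine a →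
    ∀ ξ, μ Λ' a ξ = 0)

/-- the trace pairing of two `n`-multilinear forms on `ℝ^d`, computed in the standard basis. -/
def multiPair {n : ℕ} (p q : ContinuousMultilinearMap ℝ (fun _ : Fin n => Vd d) ℝ) : ℝ :=
  ∑ ι : Fin n → Fin d,
    p (fun j => (EuclideanSpace.basisFun (Fin d) ℝ) (ι j)) *
    q (fun j => (EuclideanSpace.basisFun (Fin d) ℝ) (ι j))

/-- the action on `h` of the infinite-order constant-coefficient differential operator whose
symbol has Taylor series `p` at `0`; on polynomials `h` the sum is finite.  Its defining
property is `D(Φ)e^{⟨ξ,·⟩} = Φ(ξ)e^{⟨ξ,·⟩}`. -/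
def DOp (p : FormalMultilinearSeries ℝ (Vd d) ℝ) (h : Vd d → ℝ) (x : Vd d) : ℝ :=
  ∑ᶠ n : ℕ, multiPair (p n) (iteratedFDeriv ℝ n h x)

/-- `h` is a polynomial function on `ℝ^d`. -/
def IsPolyFun (h : Vd d → ℝ) : Prop :=
  ∃ p : MvPolynomial (Fin d) ℝ, ∀ x : Vd d, h x = MvPolynomial.eval (fun i => x i) p

/-- `h` is a polynomial function of degree at most `r` on `ℝ^d`. -/
def IsPolyFunOfDeg (h : Vd d → ℝ) (r : ℕ) : Prop :=
  ∃ p : MvPolynomial (Fin d) ℝ, p.totalDegree ≤ r ∧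
    ∀ x : Vd d, h x = MvPolynomial.eval (fun i => x i) p

end


/-! ### Meromorphic algebra -/

namespace BV

def Rat' (x : ℝ) : Prop := ∃ q : ℚ, x = (q : ℝ)

lemma Rat'.add {x y : ℝ} (hx : Rat' x) (hy : Rat' y) : Rat' (x + y) := by
  obtain ⟨a, rfl⟩ := hx; obtain ⟨b, rfl⟩ := hy; exact ⟨a + b, by push_cast; rfl⟩
lemma Rat'.sub {x y : ℝ} (hx : Rat' x) (hy : Rat' y) : Rat' (x - y) := by
  obtain ⟨a, rfl⟩ := hx; obtain ⟨b, rfl⟩ := hy; exact ⟨a - b, by push_cast; rfl⟩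
lemma Rat'.mul {x y : ℝ} (hx : Rat' x) (hy : Rat' y) : Rat' (x * y) := by
  obtain ⟨a, rfl⟩ := hx; obtain ⟨b, rfl⟩ := hy; exact ⟨a * b, by push_cast; rfl⟩
lemma Rat'.div {x y : ℝ} (hx : Rat' x) (hy : Rat' y) : Rat' (x / y) := by
  obtain ⟨a, rfl⟩ := hx; obtain ⟨b, rfl⟩ := hy; exact ⟨a / b, by push_cast; rfl⟩
lemma Rat'.zero : Rat' 0 := ⟨0, by simp⟩
lemma Rat'.sum {ι : Type*} (s : Finset ι) (f : ι → ℝ) (h : ∀ i ∈ s, Rat' (f i)) :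
    Rat' (∑ i ∈ s, f i) :=
  Finset.sum_induction f Rat' (fun _ _ => Rat'.add) Rat'.zero h

variable {d : ℕ}

lemma ratser_add {Λ : AddSubgroup (Vd d)} {f g : Vd d → ℝ}
    (hf : HasRatSeriesAt0 Λ f) (hg : HasRatSeriesAt0 Λ g) :
    HasRatSeriesAt0 Λ (fun x => f x + g x) := by
  obtain ⟨p, hp, hpr⟩ := hf
  obtain ⟨q, hq, hqr⟩ := hg
  exact ⟨p + q, hp.add hq, fun n w hw => Rat'.add (hpr n w hw) (hqr n w hw)⟩

lemma ratser_const {Λ : AddSubgroup (Vd d)} (c : ℚ) :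
    HasRatSeriesAt0 Λ (fun _ => (c : ℝ)) := by
  refine ⟨constFormalMultilinearSeries ℝ (Vd d) (c : ℝ), hasFPowerSeriesAt_const, ?_⟩
  intro n w _
  cases n with
  | zero => exact ⟨c, by simp [constFormalMultilinearSeries]⟩
  | succ n => exact ⟨0, by simp [constFormalMultilinearSeries]⟩

lemma ratser_mul {Λ : AddSubgroup (Vd d)} {f g : Vd d → ℝ}
    (hf : HasRatSeriesAt0 Λ f) (hg : HasRatSeriesAt0 Λ g) :
    HasRatSeriesAt0 Λ (fun x => f x * g x) := by
  obtain ⟨p, hp, hpr⟩ := hf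
  obtain ⟨q, hq, hqr⟩ := hg
  have h1 := hp.prod hq
  have h2 := (ContinuousLinearMap.mul ℝ ℝ).hasFPowerSeriesAt_bilinear (f 0, g 0)
  have h3 := HasFPowerSeriesAt.comp (f := fun x => (f x, g x)) h2 h1
  have hf0 : Rat' (f 0) := by
    have := hpr 0 Fin.elim0 (fun i => i.elim0)
    rwa [show f 0 = p 0 Fin.elim0 from (hp.coeff_zero _).symm]
  have hg0 : Rat' (g 0) := by
    have := hqr 0 Fin.elim0 (fun i => i.elim0)
    rwa [show g 0 = q 0 Fin.elim0 from (hq.coeff_zero _).symm]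
  refine ⟨_, h3, ?_⟩
  intro n w hw
  change Rat' _
  rw [FormalMultilinearSeries.comp, ContinuousMultilinearMap.sum_apply]
  apply Rat'.sum
  intro c _
  rw [FormalMultilinearSeries.compAlongComposition_apply]
  have hr : ∀ i, Rat' ((p.prod q).applyComposition c w i).1 ∧
      Rat' ((p.prod q).applyComposition c w i).2 := fun i =>
    ⟨hpr _ _ (fun j => hw _), hqr _ _ (fun j => hw _)⟩
  generalize (p.prod q).applyComposition c w = v at hr
  revert v
  generalize c.length = m
  intro v hr
  match m, v, hr with
  | 0, v, hr => simpa using hf0.mul hg0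
  | 1, v, hr => simpa using (hf0.mul (hr 0).2).add ((hr 0).1.mul hg0)
  | 2, v, hr => simpa using (hr 0).1.mul (hr 1).2
  | n+3, v, hr => simpa using Rat'.zero

lemma germ_mul {Λ : AddSubgroup (Vd d)} {f g : Vd d → ℝ}
    (hf : HasRatSeriesAt0 Λ f) (hg : HasRatSeriesAt0 Λ g)
    (hf0 : ¬ ∀ᶠ ξ in 𝓝 (0 : Vd d), f ξ = 0) (hg0 : ¬ ∀ᶠ ξ in 𝓝 (0 : Vd d), g ξ = 0) :
    ¬ ∀ᶠ ξ in 𝓝 (0 : Vd d), f ξ * g ξ = 0 := by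
  intro h
  obtain ⟨p, hp, -⟩ := hf
  obtain ⟨q, hq, -⟩ := hg
  obtain ⟨r₁, hr₁, h₁⟩ := hp.analyticAt.exists_ball_analyticOnNhd
  obtain ⟨r₂, hr₂, h₂⟩ := hq.analyticAt.exists_ball_analyticOnNhd
  obtain ⟨r₃, hr₃, h₃⟩ := Metric.eventually_nhds_iff_ball.1 h
  set r := min r₁ (min r₂ r₃)
  have hr : 0 < r := by positivity
  have e1 : Metric.ball (0 : Vd d) r ⊆ Metric.ball 0 r₁ :=
    Metric.ball_subset_ball (min_le_left _ _)
  have e2 : Metric.ball (0 : Vd d) r ⊆ Metric.ball 0 r₂ :=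
    Metric.ball_subset_ball ((min_le_right _ _).trans (min_le_left _ _))
  have e3 : Metric.ball (0 : Vd d) r ⊆ Metric.ball 0 r₃ :=
    Metric.ball_subset_ball ((min_le_right _ _).trans (min_le_right _ _))
  have : ∃ x ∈ Metric.ball (0 : Vd d) r, f x ≠ 0 := by
    by_contra! hcon
    exact hf0 (Filter.mem_of_superset (Metric.ball_mem_nhds 0 hr) hcon)
  obtain ⟨x, hx, hfx⟩ := this
  have hgx : g =ᶠ[𝓝 x] 0 := by
    have c1 : ∀ᶠ y in 𝓝 x, f y ≠ 0 := (h₁ x (e1 hx)).continuousAt.eventually_ne hfx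
    filter_upwards [c1, Metric.isOpen_ball.mem_nhds hx] with y hy1 hy2
    have := h₃ y (e3 hy2)
    simpa [hy1] using this
  have := (h₂.mono e2).eqOn_zero_of_preconnected_of_eventuallyEq_zero
    (convex_ball (0 : Vd d) r).isPreconnected hx hgx
  exact hg0 (Filter.mem_of_superset (Metric.ball_mem_nhds 0 hr) this)

lemma mero_add {Λ : AddSubgroup (Vd d)} {f g : Vd d → ℝ}
    (hf : RatMeromorphicAt0 Λ f) (hg : RatMeromorphicAt0 Λ g) :
    RatMeromorphicAt0 Λ (fun x => f x + g x) := by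
  obtain ⟨g1, h1, a1, b1, c1, e1⟩ := hf
  obtain ⟨g2, h2, a2, b2, c2, e2⟩ := hg
  refine ⟨_, _, ratser_add (ratser_mul a1 b2) (ratser_mul a2 b1), ratser_mul b1 b2,
    germ_mul b1 b2 c1 c2, ?_⟩
  filter_upwards [e1, e2] with x hx1 hx2 hne
  have := hx1 (left_ne_zero_of_mul hne)
  have := hx2 (right_ne_zero_of_mul hne)
  grind

lemma mero_mul {Λ : AddSubgroup (Vd d)} {f g : Vd d → ℝ}
    (hf : RatMeromorphicAt0 Λ f) (hg : RatMeromorphicAt0 Λ g) :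
    RatMeromorphicAt0 Λ (fun x => f x * g x) := by
  obtain ⟨g1, h1, a1, b1, c1, e1⟩ := hf
  obtain ⟨g2, h2, a2, b2, c2, e2⟩ := hg
  refine ⟨_, _, ratser_mul a1 a2, ratser_mul b1 b2,
    germ_mul b1 b2 c1 c2, ?_⟩
  filter_upwards [e1, e2] with x hx1 hx2 hne
  have := hx1 (left_ne_zero_of_mul hne)
  have := hx2 (right_ne_zero_of_mul hne)
  grind

lemma mero_const {Λ : AddSubgroup (Vd d)} (c : ℚ) :
    RatMeromorphicAt0 Λ (fun _ => (c : ℝ)) := by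
  refine ⟨_, _, ratser_const c, ratser_const 1, ?_, ?_⟩
  · intro h; have := h.self_of_nhds; simp at this
  · simp

lemma mero_sub {Λ : AddSubgroup (Vd d)} {f g : Vd d → ℝ}
    (hf : RatMeromorphicAt0 Λ f) (hg : RatMeromorphicAt0 Λ g) :
    RatMeromorphicAt0 Λ (fun x => f x - g x) := by
  have := mero_add hf (mero_mul (mero_const (-1)) hg)
  convert this using 2
  push_cast; ring

lemma mero_sum {Λ : AddSubgroup (Vd d)} {ι : Type*} (s : Finset ι) (f : ι → Vd d → ℝ)
    (hf : ∀ i ∈ s, RatMeromorphicAt0 Λ (f i)) :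
    RatMeromorphicAt0 Λ (fun x => ∑ i ∈ s, f i x) := by
  classical
  induction s using Finset.induction_on with
  | empty => simpa using mero_const (Λ := Λ) 0
  | insert a s ha ih =>
    simp only [Finset.sum_insert ha]
    exact mero_add (hf a (by simp)) (ih fun i hi => hf i (by simp [hi]))

lemma mero_inv {Λ : AddSubgroup (Vd d)} {f : Vd d → ℝ}
    (hf : RatMeromorphicAt0 Λ f) (hne : ∀ x, f x ≠ 0) :
    RatMeromorphicAt0 Λ (fun x => (f x)⁻¹) := by
  obtain ⟨g1, h1, a1, b1, c1, e1⟩ := hf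
  have cg : ¬ ∀ᶠ ξ in 𝓝 (0 : Vd d), g1 ξ = 0 := by
    intro h
    apply c1
    filter_upwards [h, e1] with x hx hx2
    by_contra hh
    have := hx2 hh
    rw [hx] at this
    exact (mul_ne_zero (hne x) hh) this
  refine ⟨_, _, ratser_mul b1 b1, ratser_mul a1 b1, germ_mul a1 b1 cg c1, ?_⟩
  filter_upwards [e1] with x hx h
  have := hx (right_ne_zero_of_mul h)
  rw [← this]
  have := hne x
  field_simp

lemma ratser_change {Λ Λ' : AddSubgroup (Vd d)} {f : Vd d → ℝ} (N : ℤ) (hN : N ≠ 0)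
    (h : ∀ x ∈ Λ', (N : ℝ) • x ∈ Λ) (hf : HasRatSeriesAt0 Λ' f) : HasRatSeriesAt0 Λ f := by
  obtain ⟨p, hp, hr⟩ := hf
  refine ⟨p, hp, fun n w hw => ?_⟩
  have h1 := hr n (fun i => (N : ℝ) • w i) (fun i x hx => by
    obtain ⟨m, hm⟩ := hw i _ (h x hx)
    refine ⟨m, ?_⟩
    rw [← hm]
    simp [pairE, inner_smul_left, inner_smul_right])
  rw [ContinuousMultilinearMap.map_smul_univ] at h1
  obtain ⟨q, hq⟩ := h1
  refine ⟨q / (N : ℚ) ^ n, ?_⟩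
  have : (N : ℝ) ≠ 0 := by exact_mod_cast hN
  push_cast
  rw [← hq]
  simp
  field_simp

lemma mero_change {Λ Λ' : AddSubgroup (Vd d)} {f : Vd d → ℝ} (N : ℤ) (hN : N ≠ 0)
    (h : ∀ x ∈ Λ', (N : ℝ) • x ∈ Λ) (hf : RatMeromorphicAt0 Λ' f) : RatMeromorphicAt0 Λ f := by
  obtain ⟨g1, h1, a1, b1, c1, e1⟩ := hf
  exact ⟨g1, h1, ratser_change N hN h a1, ratser_change N hN h b1, c1, e1⟩

end BV


/-! ### Rationality, projections, Weyl's theorem -/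

namespace BV

variable {d : ℕ}

lemma pairE_add (φ x y : Vd d) : pairE φ (x + y) = pairE φ x + pairE φ y := by
  simp [pairE, inner_add_right]
lemma pairE_sub (φ x y : Vd d) : pairE φ (x - y) = pairE φ x - pairE φ y := by
  simp [pairE, inner_sub_right]
lemma pairE_smul (φ x : Vd d) (t : ℝ) : pairE φ (t • x) = t * pairE φ x := by
  simp [pairE, inner_smul_right]
lemma pairE_zero (φ : Vd d) : pairE φ 0 = 0 := by simp [pairE]
lemma pairE_neg (φ x : Vd d) : pairE φ (-x) = - pairE φ x := by simp [pairE]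
lemma pairE_sum {ι : Type*} (s : Finset ι) (φ : Vd d) (f : ι → Vd d) :
    pairE φ (∑ i ∈ s, f i) = ∑ i ∈ s, pairE φ (f i) := by
  simp [pairE, inner_sum]
lemma pairE_ladd (φ ψ x : Vd d) : pairE (φ + ψ) x = pairE φ x + pairE ψ x := by
  simp [pairE, inner_add_left]
lemma pairE_lsmul (φ x : Vd d) (t : ℝ) : pairE (t • φ) x = t * pairE φ x := by
  simp [pairE, inner_smul_left]
lemma pairE_lsum {ι : Type*} (s : Finset ι) (x : Vd d) (f : ι → Vd d) :
    pairE (∑ i ∈ s, f i) x = ∑ i ∈ s, pairE (f i) x := by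
  simp [pairE, sum_inner]

/-- dual integral functionals separate points -/
def Sep (Λ : AddSubgroup (Vd d)) : Prop :=
  ∃ Φ : Finset (Vd d), (∀ φ ∈ Φ, IsDualIntegral Λ φ) ∧
    ∀ x, (∀ φ ∈ Φ, pairE φ x = 0) → x = 0

lemma exists_dual_vec (f : Vd d →ₗ[ℝ] ℝ) : ∃ φ : Vd d, ∀ x, pairE φ x = f x := by
  refine ⟨(InnerProductSpace.toDual ℝ (Vd d)).symm (LinearMap.toContinuousLinearMap f), ?_⟩
  intro x
  simp [pairE]

lemma sep_of_full {Λ : AddSubgroup (Vd d)} (h : IsFullLattice Λ) : Sep Λ := by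
  classical
  obtain ⟨⟨k, v, hv, rfl⟩, hspan⟩ := h
  have htop : ⊤ ≤ Submodule.span ℝ (Set.range v) := by
    rw [← hspan, Submodule.span_le]
    intro x hx
    induction hx using AddSubgroup.closure_induction with
    | mem x hx => exact Submodule.subset_span hx
    | zero => exact zero_mem _
    | add x y _ _ hx hy => exact add_mem hx hy
    | neg x _ hx => exact neg_mem hx
  let b := Module.Basis.mk hv htop
  choose φ hφ using fun i => exists_dual_vec (b.coord i)
  refine ⟨Finset.univ.image φ, ?_, ?_⟩
  · intro ψ hψ
    simp only [Finset.mem_image, Finset.mem_univ, true_and] at hψ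
    obtain ⟨i, rfl⟩ := hψ
    intro x hx
    induction hx using AddSubgroup.closure_induction with
    | mem x hx =>
      obtain ⟨j, rfl⟩ := hx
      rw [hφ]
      have : v j = b j := by simp [b]
      rw [this, b.coord_apply, b.repr_self, Finsupp.single_apply]
      split_ifs
      · exact ⟨1, by simp⟩
      · exact ⟨0, by simp⟩
    | zero => exact ⟨0, by simp [pairE_zero]⟩
    | add x y _ _ hx hy =>
      obtain ⟨m, hm⟩ := hx
      obtain ⟨n, hn⟩ := hy
      exact ⟨m + n, by rw [pairE_add, hm, hn]; push_cast; rfl⟩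
    | neg x _ hx =>
      obtain ⟨m, hm⟩ := hx
      exact ⟨-m, by rw [pairE_neg, hm]; push_cast; rfl⟩
  · intro x hx
    apply b.ext_elem
    intro i
    have := hx (φ i) (by simp)
    rw [hφ] at this
    simpa using this

lemma sep_of_sub {Λ Λ' : AddSubgroup (Vd d)} (h : Sep Λ) (N : ℤ) (hN : N ≠ 0)
    (hs : ∀ x ∈ Λ', (N : ℝ) • x ∈ Λ) : Sep Λ' := by
  classical
  obtain ⟨Φ, h1, h2⟩ := h
  refine ⟨Φ.image (fun φ => (N : ℝ) • φ), ?_, ?_⟩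
  · intro ψ hψ
    obtain ⟨φ, hφ, rfl⟩ := Finset.mem_image.1 hψ
    intro x hx
    obtain ⟨m, hm⟩ := h1 φ hφ _ (hs x hx)
    exact ⟨m, by rw [← hm, pairE_smul, pairE_lsmul]⟩
  · intro x hx
    apply h2
    intro φ hφ
    have := hx _ (Finset.mem_image_of_mem _ hφ)
    rw [pairE_lsmul] at this
    simpa [hN] using this

lemma fourier_motzkin {Λ : AddSubgroup (Vd d)} (Φ : Finset (Vd d))
    (hΦ : ∀ φ ∈ Φ, IsDualIntegral Λ φ) (v : Vd d) (hv : v ∈ Λ) :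
    ∃ Ψ : Finset (Vd d), (∀ φ ∈ Ψ, IsDualIntegral Λ φ) ∧
      ∀ x, (∀ φ ∈ Ψ, pairE φ x ≤ 0) ↔ ∃ t : ℝ, 0 ≤ t ∧ ∀ φ ∈ Φ, pairE φ (x - t • v) ≤ 0 := by
  classical
  let P := Φ.filter (fun φ => 0 < pairE φ v)
  let M := Φ.filter (fun φ => pairE φ v ≤ 0)
  let g : Vd d → Vd d → Vd d := fun p m => (-(pairE m v)) • p + (pairE p v) • m
  refine ⟨M ∪ Finset.image₂ g P M, ?_, ?_⟩
  · intro φ hφ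
    rcases Finset.mem_union.1 hφ with h | h
    · exact hΦ φ (Finset.mem_filter.1 h).1
    · obtain ⟨p, hp, m, hm, rfl⟩ := Finset.mem_image₂.1 h
      have hp1 := hΦ p (Finset.mem_filter.1 hp).1
      have hm1 := hΦ m (Finset.mem_filter.1 hm).1
      intro x hx
      obtain ⟨a, ha⟩ := hp1 x hx
      obtain ⟨b, hb⟩ := hm1 x hx
      obtain ⟨a', ha'⟩ := hp1 v hv
      obtain ⟨b', hb'⟩ := hm1 v hv
      refine ⟨-b' * a + a' * b, ?_⟩
      simp only [g, pairE_ladd, pairE_lsmul, ha, hb, ha', hb']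
      push_cast; ring
  · intro x
    constructor
    · intro h
      let T : Finset ℝ := insert 0 (P.image (fun p => pairE p x / pairE p v))
      have hT : T.Nonempty := ⟨0, by simp [T]⟩
      have h0 : 0 ≤ T.max' hT := T.le_max' 0 (by simp [T])
      refine ⟨T.max' hT, h0, ?_⟩
      intro φ hφ
      rw [pairE_sub, pairE_smul]
      by_cases hs : 0 < pairE φ v
      · have hP : φ ∈ P := Finset.mem_filter.2 ⟨hφ, hs⟩
        have : pairE φ x / pairE φ v ≤ T.max' hT := T.le_max' _ (by
          simp only [T, Finset.mem_insert, Finset.mem_image]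
          right; exact ⟨φ, hP, rfl⟩)
        rw [div_le_iff₀ hs] at this
        linarith
      · have hM : φ ∈ M := Finset.mem_filter.2 ⟨hφ, not_lt.1 hs⟩
        have hmem := T.max'_mem hT
        generalize T.max' hT = t at *
        simp only [T, Finset.mem_insert, Finset.mem_image] at hmem
        rcases hmem with h' | ⟨p, hp, rfl⟩
        · have := h φ (Finset.mem_union_left _ hM)
          rw [h']; linarith
        · have h2 := h (g p φ) (Finset.mem_union_right _ (Finset.mem_image₂_of_mem hp hM))
          have hpos : 0 < pairE p v := (Finset.mem_filter.1 hp).2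
          simp only [g, pairE_ladd, pairE_lsmul] at h2
          rw [div_mul_eq_mul_div, sub_nonpos, le_div_iff₀ hpos]
          linarith
    · rintro ⟨t, ht, h⟩ φ hφ
      rcases Finset.mem_union.1 hφ with h' | h'
      · have h3 := Finset.mem_filter.1 h'
        have := h φ h3.1
        rw [pairE_sub, pairE_smul] at this
        nlinarith [h3.2]
      · obtain ⟨p, hp, m, hm, rfl⟩ := Finset.mem_image₂.1 h'
        have hp1 := (Finset.mem_filter.1 hp)
        have hm1 := (Finset.mem_filter.1 hm)
        have i1 := h p hp1.1
        have i2 := h m hm1.1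
        rw [pairE_sub, pairE_smul] at i1 i2
        simp only [g, pairE_ladd, pairE_lsmul]
        nlinarith [hm1.2, hp1.2]

lemma weyl {Λ : AddSubgroup (Vd d)} (hs : Sep Λ) : ∀ (n : ℕ) (v : Fin n → Vd d),
    (∀ i, v i ∈ Λ) → ∃ Φ : Finset (Vd d), (∀ φ ∈ Φ, IsDualIntegral Λ φ) ∧
      ∀ x, (∃ t : Fin n → ℝ, (∀ i, 0 ≤ t i) ∧ x = ∑ i, t i • v i) ↔
        ∀ φ ∈ Φ, pairE φ x ≤ 0 := by
  classical
  intro n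
  induction n with
  | zero =>
    intro v _
    obtain ⟨Φ, h1, h2⟩ := hs
    refine ⟨Φ ∪ Φ.image (fun φ => (-1 : ℝ) • φ), ?_, ?_⟩
    · intro φ hφ
      rcases Finset.mem_union.1 hφ with h | h
      · exact h1 φ h
      · obtain ⟨ψ, hψ, rfl⟩ := Finset.mem_image.1 h
        intro x hx
        obtain ⟨m, hm⟩ := h1 ψ hψ x hx
        exact ⟨-m, by rw [pairE_lsmul, hm]; push_cast; ring⟩
    · intro x
      constructor
      · rintro ⟨t, _, rfl⟩ φ _
        simp [pairE_zero]
      · intro h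
        refine ⟨fun _ => 0, fun _ => le_rfl, ?_⟩
        simp only [Finset.univ_eq_empty, Finset.sum_empty]
        apply h2
        intro φ hφ
        have i1 := h φ (Finset.mem_union_left _ hφ)
        have i2 := h _ (Finset.mem_union_right _ (Finset.mem_image_of_mem _ hφ))
        rw [pairE_lsmul] at i2
        linarith
  | succ n ih =>
    intro v hv
    obtain ⟨Φ, h1, h2⟩ := ih (fun i => v i.succ) (fun i => hv _)
    obtain ⟨Ψ, h3, h4⟩ := fourier_motzkin Φ h1 (v 0) (hv 0)
    refine ⟨Ψ, h3, fun x => ?_⟩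
    rw [h4]
    constructor
    · rintro ⟨t, ht, rfl⟩
      refine ⟨t 0, ht 0, ?_⟩
      rw [← h2]
      refine ⟨fun i => t i.succ, fun i => ht _, ?_⟩
      rw [Fin.sum_univ_succ]; abel
    · rintro ⟨t, ht, h⟩
      rw [← h2] at h
      obtain ⟨u, hu, hx⟩ := h
      refine ⟨Fin.cons t u, ?_, ?_⟩
      · intro i
        refine Fin.cases ?_ ?_ i
        · simpa using ht
        · intro j; simpa using hu j
      · rw [Fin.sum_univ_succ]
        simp only [Fin.cons_zero, Fin.cons_succ]
        rw [← hx]; abel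

/-! rational points -/

lemma zsmul_mem_real {Λ : AddSubgroup (Vd d)} {x : Vd d} (h : x ∈ Λ) (n : ℤ) :
    (n : ℝ) • x ∈ Λ := by
  rw [Int.cast_smul_eq_zsmul]; exact zsmul_mem h n

lemma ratpt_of_mem {Λ : AddSubgroup (Vd d)} {x : Vd d} (h : x ∈ Λ) : IsRatPoint Λ x :=
  ⟨1, one_ne_zero, by simpa using h⟩

lemma ratpt_add {Λ : AddSubgroup (Vd d)} {x y : Vd d} (hx : IsRatPoint Λ x)
    (hy : IsRatPoint Λ y) : IsRatPoint Λ (x + y) := by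
  obtain ⟨p, hp, hx⟩ := hx
  obtain ⟨q, hq, hy⟩ := hy
  refine ⟨p * q, mul_ne_zero hp hq, ?_⟩
  have := add_mem (zsmul_mem_real hx q) (zsmul_mem_real hy p)
  convert this using 1
  push_cast
  module

lemma ratpt_smul {Λ : AddSubgroup (Vd d)} {x : Vd d} {t : ℝ} (ht : Rat' t)
    (hx : IsRatPoint Λ x) : IsRatPoint Λ (t • x) := by
  obtain ⟨p, hp, hx⟩ := hx
  obtain ⟨q, rfl⟩ := ht
  refine ⟨p * q.den, mul_ne_zero hp (by exact_mod_cast q.den_ne_zero), ?_⟩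
  have := zsmul_mem_real hx q.num
  convert this using 1
  rw [smul_smul, smul_smul]
  congr 1
  have h : (q : ℝ) * q.den = q.num := by exact_mod_cast Rat.mul_den_eq_num q
  push_cast
  rw [← h]; ring

lemma ratpt_sub {Λ : AddSubgroup (Vd d)} {x y : Vd d} (hx : IsRatPoint Λ x)
    (hy : IsRatPoint Λ y) : IsRatPoint Λ (x - y) := by
  have := ratpt_add hx (ratpt_smul (t := -1) ⟨-1, by simp⟩ hy)
  convert this using 1
  module

lemma rat_of_smul {t : ℝ} {q : ℤ} (hq : q ≠ 0) (h : Rat' ((q : ℝ) * t)) : Rat' t := by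
  have h2 : Rat' (((q : ℝ) * t) / (q : ℝ)) := h.div ⟨q, by simp⟩
  have : (q : ℝ) ≠ 0 := by exact_mod_cast hq
  rwa [mul_div_cancel_left₀ _ this] at h2

lemma ratQ {Λ : AddSubgroup (Vd d)} {Q : Vd d →ₗ[ℝ] Vd d →ₗ[ℝ] ℝ} (hQ : IsRatInner Λ Q)
    {x y : Vd d} (hx : IsRatPoint Λ x) (hy : IsRatPoint Λ y) : Rat' (Q x y) := by
  obtain ⟨p, hp, hx⟩ := hx
  obtain ⟨q, hq, hy⟩ := hy
  have h : Rat' _ := hQ.2.2 _ hx _ hy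
  simp only [map_smul, LinearMap.smul_apply, smul_eq_mul] at h
  exact rat_of_smul hp (rat_of_smul hq h)

lemma gs {Λ : AddSubgroup (Vd d)} {Q : Vd d →ₗ[ℝ] Vd d →ₗ[ℝ] ℝ} (hQ : IsRatInner Λ Q)
    (s : Finset (Vd d)) : (∀ x ∈ s, IsRatPoint Λ x) → ∀ x, IsRatPoint Λ x →
      ∃ y ∈ Submodule.span ℝ (s : Set (Vd d)), IsRatPoint Λ y ∧
        ∀ z ∈ Submodule.span ℝ (s : Set (Vd d)), Q (x - y) z = 0 := by
  classical
  induction s using Finset.induction_on with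
  | empty =>
    intro _ x _
    refine ⟨0, zero_mem _, ratpt_of_mem (zero_mem _), ?_⟩
    intro z hz
    simp at hz
    simp [hz]
  | insert l s hl ih =>
    intro hs x hx
    have hs' : ∀ x ∈ s, IsRatPoint Λ x := fun x hx => hs x (by simp [hx])
    have ih := ih hs'
    have hlr : IsRatPoint Λ l := hs l (by simp)
    obtain ⟨yl, m1, r1, o1⟩ := ih l hlr
    obtain ⟨yx, m2, r2, o2⟩ := ih x hx
    set l' := l - yl with hl'
    have rl' : IsRatPoint Λ l' := ratpt_sub hlr r1
    have mono : Submodule.span ℝ (s : Set (Vd d)) ≤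
        Submodule.span ℝ ((insert l s : Finset (Vd d)) : Set (Vd d)) :=
      Submodule.span_mono (by simp)
    have lmem : l ∈ Submodule.span ℝ ((insert l s : Finset (Vd d)) : Set (Vd d)) :=
      Submodule.subset_span (by simp)
    have key : ∀ w : Vd d, (∀ z ∈ Submodule.span ℝ (s : Set (Vd d)), Q w z = 0) → Q w l' = 0 →
        ∀ z ∈ Submodule.span ℝ ((insert l s : Finset (Vd d)) : Set (Vd d)), Q w z = 0 := by
      intro w h1 h2 z hz
      have hw : Q w l = 0 := by
        rw [show l = l' + yl by simp [hl'], map_add, h2, h1 _ m1, add_zero]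
      induction hz using Submodule.span_induction with
      | mem z hz =>
        simp only [Finset.coe_insert, Set.mem_insert_iff] at hz
        rcases hz with rfl | hz
        · exact hw
        · exact h1 _ (Submodule.subset_span hz)
      | zero => simp
      | add a b _ _ ha hb => rw [map_add, ha, hb, add_zero]
      | smul a b _ hb => rw [map_smul, hb, smul_zero]
    by_cases h0 : l' = 0
    · refine ⟨yx, mono m2, r2, key _ o2 ?_⟩
      rw [h0, map_zero]
    · have hp := hQ.2.1 l' h0
      refine ⟨yx + (Q (x - yx) l' / Q l' l') • l', ?_, ?_, ?_⟩
      · exact add_mem (mono m2) (Submodule.smul_mem _ _ (sub_mem lmem (mono m1)))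
      · exact ratpt_add r2 (ratpt_smul ((ratQ hQ (ratpt_sub hx r2) rl').div (ratQ hQ rl' rl')) rl')
      · apply key
        · intro z hz
          rw [← sub_sub, map_sub, LinearMap.sub_apply, o2 z hz, map_smul, LinearMap.smul_apply,
            o1 z hz]
          simp
        · rw [← sub_sub, LinearMap.map_sub₂, map_smul, LinearMap.smul_apply,
            smul_eq_mul, div_mul_cancel₀ _ hp.ne', sub_self]

lemma coproj_unique {Q : Vd d →ₗ[ℝ] Vd d →ₗ[ℝ] ℝ} (hpos : ∀ x : Vd d, x ≠ 0 → 0 < Q x x)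
    {L : Submodule ℝ (Vd d)} {x y z : Vd d} (hy : x - y ∈ L) (hz : x - z ∈ L)
    (hy' : ∀ w ∈ L, Q y w = 0) (hz' : ∀ w ∈ L, Q z w = 0) : y = z := by
  by_contra h
  have h1 : y - z ∈ L := by
    have := sub_mem hz hy
    rwa [sub_sub_sub_cancel_left] at this
  have := hpos (y - z) (sub_ne_zero.2 h)
  have h2 : Q (y - z) (y - z) = 0 := by
    rw [LinearMap.map_sub₂, hy' _ h1, hz' _ h1, sub_zero]
  linarith

lemma IsQCoproj_unique {Q : Vd d →ₗ[ℝ] Vd d →ₗ[ℝ] ℝ} (hpos : ∀ x : Vd d, x ≠ 0 → 0 < Q x x)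
    {L : Submodule ℝ (Vd d)} {π₁ π₂ : Vd d →ₗ[ℝ] Vd d} (h1 : IsQCoproj Q L π₁)
    (h2 : IsQCoproj Q L π₂) : π₁ = π₂ :=
  LinearMap.ext fun x => coproj_unique hpos (h1.1 x) (h2.1 x) (h1.2 x) (h2.2 x)

lemma IsQCoproj_exists {Q : Vd d →ₗ[ℝ] Vd d →ₗ[ℝ] ℝ} (hsym : ∀ x y, Q x y = Q y x)
    (hpos : ∀ x : Vd d, x ≠ 0 → 0 < Q x x)
    (L : Submodule ℝ (Vd d)) : ∃ π : Vd d →ₗ[ℝ] Vd d, IsQCoproj Q L π := by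
  have hr : LinearMap.IsRefl Q := fun x y h => by rw [hsym]; exact h
  have hc : IsCompl L (LinearMap.BilinForm.orthogonal Q L) := by
    apply LinearMap.BilinForm.isCompl_orthogonal_of_restrict_nondegenerate hr
    apply LinearMap.BilinForm.nondegenerate_restrict_of_disjoint_orthogonal Q hr
    rw [Submodule.disjoint_def]
    intro x hx hx'
    by_contra h
    have := hpos x h
    have h2 := hx' x hx
    have h3 : Q x x = 0 := h2
    linarith
  refine ⟨(LinearMap.BilinForm.orthogonal Q L).subtype ∘ₗ
    Submodule.projectionOnto _ _ hc.symm, ?_, ?_⟩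
  · intro x
    obtain ⟨a, ha, b, hb, rfl⟩ := Submodule.mem_sup.1
      (show x ∈ L ⊔ LinearMap.BilinForm.orthogonal Q L by rw [hc.sup_eq_top]; trivial)
    have e1 := Submodule.projectionOnto_apply_left hc.symm ⟨b, hb⟩
    have e2 := Submodule.projectionOnto_apply_right hc.symm ⟨a, ha⟩
    simp only at e1 e2
    simp only [LinearMap.comp_apply, Submodule.subtype_apply, map_add, e1, e2]
    simpa using ha
  · intro x y hy
    have : Q y _ = 0 := (Submodule.projectionOnto _ _ hc.symm x).2 y hy
    rw [hsym]; exact this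

lemma ratproj {Λ : AddSubgroup (Vd d)} {Q : Vd d →ₗ[ℝ] Vd d →ₗ[ℝ] ℝ} (hQ : IsRatInner Λ Q)
    (s : Finset (Vd d)) (hs : ∀ x ∈ s, x ∈ Λ) {π : Vd d →ₗ[ℝ] Vd d}
    (hπ : IsQCoproj Q (Submodule.span ℝ (s : Set (Vd d))) π) (x : Vd d) (hx : x ∈ Λ) :
    IsRatPoint Λ (π x) := by
  obtain ⟨y, m, r, o⟩ := gs hQ s (fun x hx => ratpt_of_mem (hs x hx)) x (ratpt_of_mem hx)
  have : π x = x - y := coproj_unique hQ.2.1 (hπ.1 x) (by simpa using m) (hπ.2 x) o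
  rw [this]
  exact ratpt_sub (ratpt_of_mem hx) r

lemma unif {Λ : AddSubgroup (Vd d)} (G : Finset (Vd d)) (π : Vd d →ₗ[ℝ] Vd d)
    (h : ∀ g ∈ G, IsRatPoint Λ (π g)) :
    ∃ N : ℤ, N ≠ 0 ∧ ∀ x ∈ AddSubgroup.closure (G : Set (Vd d)), (N : ℝ) • π x ∈ Λ := by
  classical
  have : ∃ N : ℤ, N ≠ 0 ∧ ∀ x ∈ G, (N : ℝ) • π x ∈ Λ := by
    induction G using Finset.induction_on with
    | empty => exact ⟨1, one_ne_zero, by simp⟩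
    | insert a s ha ih =>
      obtain ⟨N, hN, h1⟩ := ih fun g hg => h g (by simp [hg])
      obtain ⟨M, hM, h2⟩ := h a (by simp)
      refine ⟨N * M, mul_ne_zero hN hM, ?_⟩
      intro x hx
      rcases Finset.mem_insert.1 hx with rfl | hx
      · have := zsmul_mem_real h2 N
        rw [smul_smul] at this; exact_mod_cast this
      · have := zsmul_mem_real (h1 x hx) M
        rw [smul_smul, mul_comm] at this; exact_mod_cast this
  obtain ⟨N, hN, h1⟩ := this
  refine ⟨N, hN, fun x hx => ?_⟩
  induction hx using AddSubgroup.closure_induction with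
  | mem x hx => exact h1 x hx
  | zero => simp
  | add x y _ _ hx hy => rw [map_add, smul_add]; exact add_mem hx hy
  | neg x _ hx => rw [map_neg, smul_neg]; exact neg_mem hx

/-- the properties of quotient lattices that we use -/
structure Good (Q : Vd d →ₗ[ℝ] Vd d →ₗ[ℝ] ℝ) (Λ : AddSubgroup (Vd d)) : Prop where
  fg : ∃ G : Finset (Vd d), Λ = AddSubgroup.closure (G : Set (Vd d))
  sep : Sep Λ
  rat : IsRatInner Λ Q

lemma good_change {Q : Vd d →ₗ[ℝ] Vd d →ₗ[ℝ] ℝ} {Λ : AddSubgroup (Vd d)} (h : Good Q Λ)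
    (s : Finset (Vd d)) (hs : ∀ x ∈ s, x ∈ Λ) {π : Vd d →ₗ[ℝ] Vd d}
    (hπ : IsQCoproj Q (Submodule.span ℝ (s : Set (Vd d))) π) :
    ∃ N : ℤ, N ≠ 0 ∧ ∀ x ∈ AddSubgroup.map π.toAddMonoidHom Λ, (N : ℝ) • x ∈ Λ := by
  obtain ⟨G, hG⟩ := h.fg
  obtain ⟨N, hN, h1⟩ := unif (Λ := Λ) G π (fun g hg => ratproj h.rat s hs hπ g
    (by rw [hG]; exact AddSubgroup.subset_closure hg))
  refine ⟨N, hN, ?_⟩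
  rintro _ ⟨x, hx, rfl⟩
  exact h1 x (by rw [← hG]; exact hx)

lemma good_quot {Q : Vd d →ₗ[ℝ] Vd d →ₗ[ℝ] ℝ} {Λ : AddSubgroup (Vd d)} (h : Good Q Λ)
    (s : Finset (Vd d)) (hs : ∀ x ∈ s, x ∈ Λ) {π : Vd d →ₗ[ℝ] Vd d}
    (hπ : IsQCoproj Q (Submodule.span ℝ (s : Set (Vd d))) π) :
    Good Q (AddSubgroup.map π.toAddMonoidHom Λ) := by
  classical
  obtain ⟨N, hN, h1⟩ := good_change h s hs hπ
  refine ⟨?_, sep_of_sub h.sep N hN h1, h.rat.1, h.rat.2.1, ?_⟩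
  · obtain ⟨G, hG⟩ := h.fg
    refine ⟨G.image π, ?_⟩
    rw [hG, AddMonoidHom.map_closure]
    simp
  · intro x hx y hy
    exact ratQ h.rat ⟨N, hN, h1 x hx⟩ ⟨N, hN, h1 y hy⟩

lemma exists_finset_span {s : Set (Vd d)} : ∃ t : Finset (Vd d), (t : Set (Vd d)) ⊆ s ∧
    Submodule.span ℝ (t : Set (Vd d)) = Submodule.span ℝ s := by
  obtain ⟨t, h1, h2⟩ := (Submodule.fg_span_iff_fg_span_finset_subset s).1
    (IsNoetherian.noetherian (Submodule.span ℝ s))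
  exact ⟨t, h1, h2.symm⟩

lemma good_full {Q : Vd d →ₗ[ℝ] Vd d →ₗ[ℝ] ℝ} {Λ : AddSubgroup (Vd d)} (h : IsFullLattice Λ)
    (hQ : IsRatInner Λ Q) : Good Q Λ := by
  classical
  refine ⟨?_, sep_of_full h, hQ⟩
  obtain ⟨⟨k, v, hv, h⟩, -⟩ := h
  exact ⟨Finset.univ.image v, by simpa using h⟩

lemma good_of_quot {Q : Vd d →ₗ[ℝ] Vd d →ₗ[ℝ] ℝ} {Λ Λ' : AddSubgroup (Vd d)}
    (h : IsFullLattice Λ) (hQ : IsRatInner Λ Q) (hq : IsQuotLattice Q Λ Λ') : Good Q Λ' := by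
  obtain ⟨L, π, h1, h2, rfl⟩ := hq
  obtain ⟨t, ht1, ht2⟩ := exists_finset_span (s := (L : Set (Vd d)) ∩ (Λ : Set (Vd d)))
  rw [← h1, ← ht2] at h2
  exact good_quot (good_full h hQ) t (fun x hx => (ht1 hx).2) h2

lemma quot_quot {Q : Vd d →ₗ[ℝ] Vd d →ₗ[ℝ] ℝ} {Λ Λ' : AddSubgroup (Vd d)}
    (hq : IsQuotLattice Q Λ Λ')
    (s : Finset (Vd d)) (hs : ∀ x ∈ s, x ∈ Λ') {π : Vd d →ₗ[ℝ] Vd d}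
    (hπ : IsQCoproj Q (Submodule.span ℝ (s : Set (Vd d))) π) :
    IsQuotLattice Q Λ (AddSubgroup.map π.toAddMonoidHom Λ') := by
  obtain ⟨L, ρ, h1, h2, rfl⟩ := hq
  set M := Submodule.span ℝ (s : Set (Vd d)) with hM
  have hperp : ∀ y ∈ M, ∀ z ∈ L, Q y z = 0 := by
    intro y hy z hz
    induction hy using Submodule.span_induction with
    | mem y hy =>
      obtain ⟨x, _, rfl⟩ := hs y hy
      exact h2.2 x z hz
    | zero => simp
    | add a b _ _ ha hb => rw [map_add, LinearMap.add_apply, ha, hb, add_zero]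
    | smul a b _ hb => rw [map_smul, LinearMap.smul_apply, hb, smul_zero]
  refine ⟨L ⊔ M, π ∘ₗ ρ, ?_, ⟨?_, ?_⟩, ?_⟩
  · apply le_antisymm
    · rw [Submodule.span_le]; exact fun x hx => hx.1
    · have hL : L ≤ Submodule.span ℝ (((L ⊔ M : Submodule ℝ (Vd d)) : Set (Vd d)) ∩ (Λ : Set (Vd d))) := by
        rw [← h1, h1]
        conv_lhs => rw [← h1]
        exact Submodule.span_mono fun x hx => ⟨(le_sup_left : L ≤ L ⊔ M) hx.1, hx.2⟩
      refine sup_le hL ?_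
      rw [hM, Submodule.span_le]
      intro y hy
      obtain ⟨x, hx, rfl⟩ := hs y hy
      have e1 : x - ρ x ∈ L := h2.1 x
      have e2 : ρ x ∈ M := Submodule.subset_span hy
      have e3 : x ∈ L ⊔ M := by
        have := add_mem ((le_sup_left : L ≤ L ⊔ M) e1) ((le_sup_right : M ≤ L ⊔ M) e2)
        simpa using this
      have e4 : x ∈ Submodule.span ℝ (((L ⊔ M : Submodule ℝ (Vd d)) : Set (Vd d)) ∩ (Λ : Set (Vd d))) :=
        Submodule.subset_span ⟨e3, hx⟩
      have := sub_mem e4 (hL e1)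
      simpa using this
  · intro x
    have := add_mem ((le_sup_left : L ≤ L ⊔ M) (h2.1 x)) ((le_sup_right : M ≤ L ⊔ M) (hπ.1 (ρ x)))
    simpa using this
  · intro x y hy
    obtain ⟨a, ha, b, hb, rfl⟩ := Submodule.mem_sup.1 hy
    have e1 : Q (π (ρ x)) b = 0 := hπ.2 _ b hb
    have e2 : Q (π (ρ x)) a = 0 := by
      have e3 := hperp _ (hπ.1 (ρ x)) a ha
      rw [map_sub, LinearMap.sub_apply, h2.2 x a ha] at e3
      linarith
    simp [e1, e2]
  · rw [AddSubgroup.map_map]; rfl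

end BV


/-! ### Cones and faces -/

namespace BV

variable {d : ℕ}

def affCone {n : ℕ} (s : Vd d) (v : Fin n → Vd d) : Set (Vd d) :=
  {x | ∃ t : Fin n → ℝ, (∀ i, 0 ≤ t i) ∧ x = s + ∑ i, t i • v i}

lemma apex_mem {n : ℕ} (s : Vd d) (v : Fin n → Vd d) : s ∈ affCone s v :=
  ⟨fun _ => 0, fun _ => le_rfl, by simp⟩

lemma mem_add {n : ℕ} {s x : Vd d} {v : Fin n → Vd d} (h : x ∈ affCone s v) (i : Fin n) :
    x + v i ∈ affCone s v := by
  classical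
  obtain ⟨t, ht, rfl⟩ := h
  refine ⟨fun j => t j + if j = i then 1 else 0, ?_, ?_⟩
  · intro j
    have := ht j
    dsimp only
    split_ifs <;> linarith
  · simp [add_smul, Finset.sum_add_distrib, add_assoc]

lemma affCone_convex {n : ℕ} (s : Vd d) (v : Fin n → Vd d) : Convex ℝ (affCone s v) := by
  rintro _ ⟨t, ht, rfl⟩ _ ⟨u, hu, rfl⟩ a b ha hb hab
  refine ⟨fun i => a * t i + b * u i, ?_, ?_⟩
  · intro i
    have := ht i; have := hu i
    positivity
  · simp only [add_smul, Finset.sum_add_distrib, smul_add, Finset.smul_sum, mul_smul]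
    have : s = a • s + b • s := by rw [← add_smul, hab, one_smul]
    nth_rewrite 3 [this]
    abel

noncomputable def cutV {n : ℕ} (φ : Vd d) (v : Fin n → Vd d) : Fin n → Vd d :=
  open Classical in fun i => if pairE φ (v i) = 0 then v i else 0

lemma face_struct {n : ℕ} {s : Vd d} {v : Fin n → Vd d} {F : Set (Vd d)}
    (hF : IsFaceOf (affCone s v) F) :
    ∃ φ, (∀ i, pairE φ (v i) ≤ 0) ∧ F = affCone s (cutV φ v) := by
  classical
  obtain ⟨⟨x0, hx0⟩, φ, rfl⟩ := hF
  have hle : ∀ i, pairE φ (v i) ≤ 0 := by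
    intro i
    have := hx0.2 _ (mem_add hx0.1 i)
    rw [pairE_add] at this
    linarith
  refine ⟨φ, hle, ?_⟩
  ext x
  constructor
  · rintro ⟨⟨t, ht, rfl⟩, h2⟩
    have h3 := h2 s (apex_mem s v)
    rw [pairE_add, pairE_sum] at h3
    have h4 : ∀ i ∈ Finset.univ, pairE φ (t i • v i) ≤ 0 := by
      intro i _
      rw [pairE_smul]
      exact mul_nonpos_of_nonneg_of_nonpos (ht i) (hle i)
    have h5 : ∑ i, pairE φ (t i • v i) = 0 :=
      le_antisymm (Finset.sum_nonpos h4) (by linarith)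
    rw [Finset.sum_eq_zero_iff_of_nonpos h4] at h5
    refine ⟨t, ht, ?_⟩
    congr 1
    apply Finset.sum_congr rfl
    intro i hi
    have := h5 i hi
    rw [pairE_smul] at this
    unfold cutV
    split_ifs with hc
    · rfl
    · rcases mul_eq_zero.1 this with h | h
      · simp [h]
      · exact absurd h hc
  · rintro ⟨t, ht, rfl⟩
    have hval : pairE φ (s + ∑ i, t i • cutV φ v i) = pairE φ s := by
      rw [pairE_add, pairE_sum, Finset.sum_eq_zero, add_zero]
      intro i _
      rw [pairE_smul]
      unfold cutV
      split_ifs with hc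
      · rw [hc, mul_zero]
      · rw [pairE_zero, mul_zero]
    refine ⟨⟨fun i => if pairE φ (v i) = 0 then t i else 0, ?_, ?_⟩, ?_⟩
    · intro i
      dsimp only
      split_ifs
      · exact ht i
      · exact le_rfl
    · congr 1
      apply Finset.sum_congr rfl
      intro i _
      unfold cutV
      split_ifs with hc <;> simp [hc]
    · rintro _ ⟨u, hu, rfl⟩
      rw [hval, pairE_add, pairE_sum]
      have : ∑ i, pairE φ (u i • v i) ≤ 0 := Finset.sum_nonpos fun i _ => by
        rw [pairE_smul]
        exact mul_nonpos_of_nonneg_of_nonpos (hu i) (hle i)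
      linarith

lemma faces_finite {n : ℕ} (s : Vd d) (v : Fin n → Vd d) :
    {F | IsFaceOf (affCone s v) F}.Finite := by
  classical
  apply (Set.finite_range (fun J : Set (Fin n) =>
    affCone s (fun i => if i ∈ J then v i else 0))).subset
  intro F hF
  obtain ⟨φ, _, rfl⟩ := face_struct hF
  exact ⟨{i | pairE φ (v i) = 0}, by
    congr 1⟩

lemma line_of_dir {n : ℕ} {s u : Vd d} {v : Fin n → Vd d} (hu : u ≠ 0)
    (h1 : ∃ t : Fin n → ℝ, (∀ i, 0 ≤ t i) ∧ u = ∑ i, t i • v i)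
    (h2 : ∃ t : Fin n → ℝ, (∀ i, 0 ≤ t i) ∧ -u = ∑ i, t i • v i) :
    ContainsLine (affCone s v) := by
  obtain ⟨t, ht, h1⟩ := h1
  obtain ⟨t', ht', h2⟩ := h2
  refine ⟨s, u, hu, fun r => ?_⟩
  rcases le_total 0 r with hr | hr
  · refine ⟨fun i => r * t i, fun i => mul_nonneg hr (ht i), ?_⟩
    rw [h1, Finset.smul_sum]
    simp only [mul_smul]
  · refine ⟨fun i => (-r) * t' i, fun i => mul_nonneg (by linarith) (ht' i), ?_⟩
    have : r • u = (-r) • (-u) := by simp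
    rw [this, h2, Finset.smul_sum]
    simp only [mul_smul]

lemma dir_of_line {Λ : AddSubgroup (Vd d)} (hs : Sep Λ) {n : ℕ} {s : Vd d} {v : Fin n → Vd d}
    (hv : ∀ i, v i ∈ Λ) (h : ContainsLine (affCone s v)) :
    ∃ u, u ≠ 0 ∧ (∃ t : Fin n → ℝ, (∀ i, 0 ≤ t i) ∧ u = ∑ i, t i • v i) ∧
      (∃ t : Fin n → ℝ, (∀ i, 0 ≤ t i) ∧ -u = ∑ i, t i • v i) := by
  obtain ⟨x, u, hu, h⟩ := h
  obtain ⟨Φ, _, h2⟩ := weyl hs n v hv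
  have key : ∀ φ ∈ Φ, pairE φ u = 0 := by
    intro φ hφ
    have h3 : ∀ r : ℝ, pairE φ (x - s) + r * pairE φ u ≤ 0 := by
      intro r
      obtain ⟨t, ht, he⟩ := h r
      have := (h2 (x - s + r • u)).1 ⟨t, ht, by
        rw [sub_add_eq_add_sub, he]; abel⟩ φ hφ
      rwa [pairE_add, pairE_smul] at this
    by_contra hne
    have := h3 ((1 - pairE φ (x - s)) / pairE φ u)
    rw [div_mul_cancel₀ _ hne] at this
    linarith
  refine ⟨u, hu, (h2 _).2 fun φ hφ => (key φ hφ).le, (h2 _).2 fun φ hφ => ?_⟩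
  rw [pairE_neg, key φ hφ, neg_zero]

lemma apex_face {Λ : AddSubgroup (Vd d)} (hs : Sep Λ) {n : ℕ} {s : Vd d} {v : Fin n → Vd d}
    (hv : ∀ i, v i ∈ Λ) (h : ¬ ContainsLine (affCone s v)) : IsFaceOf (affCone s v) {s} := by
  obtain ⟨Φ, _, h2⟩ := weyl hs n v hv
  have hle : ∀ x ∈ affCone s v, ∀ φ ∈ Φ, pairE φ (x - s) ≤ 0 := by
    rintro _ ⟨t, ht, rfl⟩
    exact (h2 _).1 ⟨t, ht, by abel⟩
  refine ⟨⟨s, rfl⟩, ∑ φ ∈ Φ, φ, ?_⟩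
  ext x
  simp only [Set.mem_singleton_iff, Set.mem_ofPred_eq]
  constructor
  · rintro rfl
    refine ⟨apex_mem _ _, fun y hy => ?_⟩
    have : pairE (∑ φ ∈ Φ, φ) (y - x) ≤ 0 := by
      rw [pairE_lsum]; exact Finset.sum_nonpos (hle y hy)
    rw [pairE_sub] at this
    linarith
  · rintro ⟨hx, hmax⟩
    by_contra hne
    have h3 := hmax s (apex_mem _ _)
    have h4 : ∑ φ ∈ Φ, pairE φ (x - s) = 0 := by
      apply le_antisymm (Finset.sum_nonpos (hle x hx))
      rw [← pairE_lsum, pairE_sub]; linarith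
    rw [Finset.sum_eq_zero_iff_of_nonpos (hle x hx)] at h4
    refine h (line_of_dir (u := x - s) (sub_ne_zero.2 hne)
      ((h2 _).2 fun φ hφ => (h4 φ hφ).le) ((h2 _).2 fun φ hφ => ?_))
    rw [pairE_neg, h4 φ hφ, neg_zero]

lemma ratpt_span {Λ : AddSubgroup (Vd d)} {s : Vd d} (h : IsRatPoint Λ s) :
    s ∈ Submodule.span ℝ (Λ : Set (Vd d)) := by
  obtain ⟨q, hq, h⟩ := h
  have h2 : ((q : ℝ)⁻¹) • ((q : ℝ) • s) ∈ Submodule.span ℝ (Λ : Set (Vd d)) :=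
    Submodule.smul_mem _ _ (Submodule.subset_span h)
  rwa [smul_smul, inv_mul_cancel₀ (by exact_mod_cast hq), one_smul] at h2

lemma cone_polyhedron {Λ : AddSubgroup (Vd d)} (hs : Sep Λ) {a : Set (Vd d)}
    (h : IsRatAffineCone Λ a) : IsRatPolyhedron Λ a := by
  obtain ⟨s, n, v, hsr, hv, rfl⟩ := h
  obtain ⟨Φ, h1, h2⟩ := weyl hs n v hv
  have hrat : ∀ φ, IsDualIntegral Λ φ → Rat' (pairE φ s) := by
    intro φ hφ
    obtain ⟨q, hq, h⟩ := hsr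
    obtain ⟨m, hm⟩ := hφ _ h
    rw [pairE_smul] at hm
    exact rat_of_smul hq ⟨m, by rw [hm]; simp⟩
  let e := Φ.equivFin.symm
  have hc : ∀ i, ∃ c : ℚ, pairE (e i : Vd d) s = c := fun i => hrat _ (h1 _ (e i).2)
  choose c hc using hc
  refine ⟨Φ.card, fun i => (e i : Vd d), c, fun i => h1 _ (e i).2, ?_⟩
  ext x
  simp only [Set.mem_ofPred_eq]
  have h3 := h2 (x - s)
  constructor
  · rintro ⟨t, ht, rfl⟩
    refine ⟨add_mem (ratpt_span hsr) (Submodule.sum_mem _ fun i _ =>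
      Submodule.smul_mem _ _ (Submodule.subset_span (hv i))), fun i => ?_⟩
    have := h3.1 ⟨t, ht, by abel⟩ _ (e i).2
    rw [pairE_sub] at this
    rw [← hc]; linarith
  · rintro ⟨_, h4⟩
    obtain ⟨t, ht, h5⟩ := h3.2 (fun φ hφ => by
      have := h4 (e.symm ⟨φ, hφ⟩)
      rw [← hc] at this
      simp only [Equiv.apply_symm_apply] at this
      rw [pairE_sub]; linarith)
    exact ⟨t, ht, by rw [← h5]; abel⟩

lemma direction_affCone {n : ℕ} (s : Vd d) (w : Fin n → Vd d) :
    (affineSpan ℝ (affCone s w)).direction = Submodule.span ℝ (Set.range w) := by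
  rw [direction_affineSpan]
  apply le_antisymm
  · rw [vectorSpan_def, Submodule.span_le]
    rintro _ ⟨_, ⟨t, _, rfl⟩, _, ⟨u, _, rfl⟩, rfl⟩
    have : ∀ t : Fin n → ℝ, ∑ i, t i • w i ∈ Submodule.span ℝ (Set.range w) := fun t =>
      Submodule.sum_mem _ fun i _ => Submodule.smul_mem _ _ (Submodule.subset_span ⟨i, rfl⟩)
    simpa using sub_mem (this t) (this u)
  · rw [Submodule.span_le]
    rintro _ ⟨i, rfl⟩
    have := vsub_mem_vectorSpan ℝ (mem_add (apex_mem s w) i) (apex_mem s w)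
    simpa using this

lemma image_affCone {n : ℕ} (s : Vd d) (v : Fin n → Vd d) (π : Vd d →ₗ[ℝ] Vd d) :
    π '' affCone s v = affCone (π s) (fun i => π (v i)) := by
  ext x
  constructor
  · rintro ⟨_, ⟨t, ht, rfl⟩, rfl⟩
    exact ⟨t, ht, by simp⟩
  · rintro ⟨t, ht, rfl⟩
    exact ⟨_, ⟨t, ht, rfl⟩, by simp⟩

lemma image_suppCone {n : ℕ} {s : Vd d} {v : Fin n → Vd d} {F : Set (Vd d)}
    (hF : IsFaceOf (affCone s v) F) (hsF : s ∈ F) (hFc : Convex ℝ F) {π : Vd d →ₗ[ℝ] Vd d}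
    (hπ : ∀ x ∈ (affineSpan ℝ F).direction, π x = 0) :
    π '' suppCone (affCone s v) F = π '' affCone s v := by
  have hFa : F ⊆ affCone s v := by
    obtain ⟨_, φ, rfl⟩ := hF
    exact fun x hx => hx.1
  have hs : ∀ x ∈ affineSpan ℝ F, π x = π s := by
    intro x hx
    have := hπ _ (AffineSubspace.vsub_mem_direction hx (subset_affineSpan ℝ F hsF))
    rw [vsub_eq_sub, map_sub, sub_eq_zero] at this
    exact this
  apply subset_antisymm
  · rintro _ ⟨z, ⟨α, hα, u, ⟨x, hx, ε, hε, h⟩, rfl⟩, rfl⟩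
    rw [map_add, hs α hα, image_affCone]
    have hxF := hs x (subset_affineSpan ℝ F (intrinsicInterior_subset hx))
    obtain ⟨t, ht, h1⟩ := h ε hε le_rfl
    have h2 := congrArg π h1
    rw [map_add, map_smul, hxF, map_add, add_right_inj, map_sum] at h2
    refine ⟨fun i => ε⁻¹ * t i, fun i => mul_nonneg (by positivity) (ht i), ?_⟩
    congr 1
    have h3 : π u = ε⁻¹ • (ε • π u) := by
      rw [smul_smul, inv_mul_cancel₀ hε.ne', one_smul]
    rw [h3, h2, Finset.smul_sum]
    simp [mul_smul]
  · apply Set.image_mono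
    intro y hy
    obtain ⟨x, hx⟩ := Set.Nonempty.intrinsicInterior hFc ⟨s, hsF⟩
    have hxF := intrinsicInterior_subset hx
    refine ⟨x, subset_affineSpan ℝ F hxF, y - x, ⟨x, hx, 1, one_pos, ?_⟩, by abel⟩
    intro t ht ht1
    have := affCone_convex s v (hFa hxF) hy (a := 1 - t) (b := t) (by linarith) ht.le (by ring)
    convert this using 1
    module

lemma coproj_ker {Q : Vd d →ₗ[ℝ] Vd d →ₗ[ℝ] ℝ} (hpos : ∀ x : Vd d, x ≠ 0 → 0 < Q x x)
    {L : Submodule ℝ (Vd d)} {π : Vd d →ₗ[ℝ] Vd d} (h : IsQCoproj Q L π) {x : Vd d}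
    (hx : x ∈ L) : π x = 0 :=
  coproj_unique hpos (h.1 x) (by simpa using hx) (h.2 x) (by simp)

lemma cone_facts {Q : Vd d →ₗ[ℝ] Vd d →ₗ[ℝ] ℝ} {Λ : AddSubgroup (Vd d)} (hG : Good Q Λ)
    {a : Set (Vd d)} (ha : IsRatAffineCone Λ a) (hl : ¬ ContainsLine a) :
    {F | IsFaceOf a F}.Finite ∧ ∃ s, s ∈ a ∧ IsRatAffineCone Λ {s} ∧ IsFaceOf a {s} ∧
      ∀ F, IsFaceOf a F → IsRatAffineCone Λ F ∧
        ∃ T : Finset (Vd d), (∀ x ∈ T, x ∈ Λ) ∧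
          (affineSpan ℝ F).direction = Submodule.span ℝ (T : Set (Vd d)) ∧
          (F = {s} ∨ ∃ w ∈ T, w ≠ 0) ∧
          ∀ π, IsQCoproj Q (affineSpan ℝ F).direction π →
            π '' suppCone a F = π '' a ∧
            IsRatAffineCone (AddSubgroup.map π.toAddMonoidHom Λ) (π '' a) ∧
            ¬ ContainsLine (π '' a) := by
  classical
  obtain ⟨s, n, v, hsr, hv, ha⟩ := ha
  change a = affCone s v at ha
  subst ha
  refine ⟨faces_finite s v, s, apex_mem s v, ?_, apex_face hG.sep hv hl, ?_⟩
  · exact ⟨s, 0, Fin.elim0, hsr, fun i => i.elim0, by ext x; simp⟩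
  intro F hF
  obtain ⟨φ, hle, hFeq⟩ := face_struct hF
  have hw : ∀ i, cutV φ v i ∈ Λ := by
    intro i
    unfold cutV
    split_ifs
    · exact hv i
    · exact zero_mem _
  have hdir : (affineSpan ℝ F).direction =
      Submodule.span ℝ ((Finset.univ.image (cutV φ v) : Finset (Vd d)) : Set (Vd d)) := by
    rw [hFeq, direction_affCone]; simp
  have hTmem : ∀ x ∈ (Finset.univ.image (cutV φ v) : Finset (Vd d)), x ∈ Λ := by
    intro x hx
    obtain ⟨i, _, rfl⟩ := Finset.mem_image.1 hx
    exact hw i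
  refine ⟨⟨s, n, cutV φ v, hsr, hw, hFeq⟩, Finset.univ.image (cutV φ v), hTmem, hdir, ?_, ?_⟩
  · by_cases h : ∃ i, cutV φ v i ≠ 0
    · obtain ⟨i, hi⟩ := h
      exact Or.inr ⟨_, by simp, hi⟩
    · push Not at h
      left
      rw [hFeq]
      ext x
      simp only [affCone, h, smul_zero, Finset.sum_const_zero, add_zero, Set.mem_ofPred_eq,
        Set.mem_singleton_iff]
      exact ⟨fun ⟨t, _, hx⟩ => hx, fun hx => ⟨fun _ => 0, fun _ => le_rfl, hx⟩⟩
  · intro π hπ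
    have hker : ∀ x ∈ (affineSpan ℝ F).direction, π x = 0 := fun x hx =>
      coproj_ker hG.rat.2.1 hπ hx
    refine ⟨image_suppCone hF (by rw [hFeq]; exact apex_mem _ _)
      (by rw [hFeq]; exact affCone_convex _ _) hker, ?_, ?_⟩
    · obtain ⟨q, hq, hqs⟩ := hsr
      exact ⟨π s, n, fun i => π (v i), ⟨q, hq, ⟨_, hqs, by simp⟩⟩, fun i => ⟨_, hv i, rfl⟩,
        image_affCone s v π⟩
    · have hG' := good_quot hG _ hTmem (hdir ▸ hπ)
      rw [image_affCone]
      intro hline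
      obtain ⟨u, hu, ⟨t, ht, h1⟩, ⟨t', ht', h2⟩⟩ :=
        dir_of_line (v := fun i => π (v i)) hG'.sep (fun i => ⟨_, hv i, rfl⟩) hline
      have hφdir : ∀ x ∈ (affineSpan ℝ F).direction, pairE φ x = 0 := by
        intro x hx
        rw [hdir] at hx
        induction hx using Submodule.span_induction with
        | mem y hy =>
          simp only [Finset.coe_image, Finset.coe_univ, Set.image_univ, Set.mem_range] at hy
          obtain ⟨i, rfl⟩ := hy
          unfold cutV
          split_ifs with hc
          · exact hc
          · exact pairE_zero φ
        | zero => exact pairE_zero φ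
        | add a b _ _ ha hb => rw [pairE_add, ha, hb, add_zero]
        | smul a b _ hb => rw [pairE_smul, hb, mul_zero]
      have hφπ : ∀ x, pairE φ (π x) = pairE φ x := by
        intro x
        have := hφdir _ (hπ.1 x)
        rw [pairE_sub] at this
        linarith
      have hterm : ∀ (t : Fin n → ℝ), (∀ i, 0 ≤ t i) → ∀ i ∈ Finset.univ,
          t i * pairE φ (v i) ≤ 0 :=
        fun t ht i _ => mul_nonpos_of_nonneg_of_nonpos (ht i) (hle i)
      have e1 : pairE φ u = ∑ i, t i * pairE φ (v i) := by
        rw [h1, pairE_sum]; simp only [pairE_smul, hφπ]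
      have e2 : - pairE φ u = ∑ i, t' i * pairE φ (v i) := by
        rw [← pairE_neg, h2, pairE_sum]; simp only [pairE_smul, hφπ]
      have e3 := Finset.sum_nonpos (hterm t ht)
      have e4 := Finset.sum_nonpos (hterm t' ht')
      have e5 : ∑ i, t i * pairE φ (v i) = 0 := by linarith
      rw [Finset.sum_eq_zero_iff_of_nonpos (hterm t ht)] at e5
      apply hu
      rw [h1]
      apply Finset.sum_eq_zero
      intro i hi
      rcases mul_eq_zero.1 (e5 i hi) with h | h
      · simp [h]
      · have : v i ∈ (affineSpan ℝ F).direction := by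
          rw [hdir]
          apply Submodule.subset_span
          simp only [Finset.coe_image, Finset.coe_univ, Set.image_univ, Set.mem_range]
          exact ⟨i, by simp [cutV, h]⟩
        rw [hker _ this, smul_zero]

/-- rank of a lattice -/
noncomputable def rk (Λ : AddSubgroup (Vd d)) : ℕ :=
  Module.finrank ℝ (Submodule.span ℝ (Λ : Set (Vd d)))

lemma rk_lt {Q : Vd d →ₗ[ℝ] Vd d →ₗ[ℝ] ℝ} (hpos : ∀ x : Vd d, x ≠ 0 → 0 < Q x x)
    {Λ : AddSubgroup (Vd d)} {T : Finset (Vd d)} (hT : ∀ x ∈ T, x ∈ Λ) {w : Vd d}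
    (hw : w ∈ T) (hw0 : w ≠ 0) {π : Vd d →ₗ[ℝ] Vd d}
    (hπ : IsQCoproj Q (Submodule.span ℝ (T : Set (Vd d))) π) :
    rk (AddSubgroup.map π.toAddMonoidHom Λ) < rk Λ := by
  apply Submodule.finrank_lt_finrank_of_lt
  have hperp : ∀ x ∈ Submodule.span ℝ ((AddSubgroup.map π.toAddMonoidHom Λ : AddSubgroup (Vd d)) : Set (Vd d)),
      Q x w = 0 := by
    intro x hx
    induction hx using Submodule.span_induction with
    | mem y hy =>
      obtain ⟨z, _, rfl⟩ := hy
      exact hπ.2 z w (Submodule.subset_span hw)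
    | zero => simp
    | add a b _ _ ha hb => rw [map_add, LinearMap.add_apply, ha, hb, add_zero]
    | smul a b _ hb => rw [map_smul, LinearMap.smul_apply, hb, smul_zero]
  refine lt_of_le_of_ne ?_ ?_
  · rw [Submodule.span_le]
    rintro _ ⟨z, hz, rfl⟩
    have h1 := Submodule.span_mono (R := ℝ) (s := (T : Set (Vd d))) (t := (Λ : Set (Vd d)))
      hT (hπ.1 z)
    have h2 : z ∈ Submodule.span ℝ (Λ : Set (Vd d)) := Submodule.subset_span hz
    have := sub_mem h2 h1
    simpa using this
  · intro he
    have : w ∈ Submodule.span ℝ (Λ : Set (Vd d)) := Submodule.subset_span (hT w hw)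
    rw [← he] at this
    have h1 := hperp w this
    have h2 := hpos w hw0
    linarith

lemma I_point {Λ : AddSubgroup (Vd d)} {I : Set (Vd d) → Vd d → ℝ} (hI : IsIMap Λ I) {s : Vd d}
    (hs : IsRatPolyhedron Λ {s}) (ξ : Vd d) : I {s} ξ = Real.exp (pairE ξ s) := by
  have hm : IsCanonicalMeasure Λ ((affineSpan ℝ {s} : AffineSubspace ℝ (Vd d)) : Set (Vd d))
      (Measure.dirac s) := by
    refine ⟨0, s, Fin.elim0, by simp, fun i => i.elim0, linearIndependent_empty_type, ?_, ?_, ?_⟩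
    · ext x; simp
    · intro y _ hy
      refine ⟨Fin.elim0, ?_⟩
      have : y = 0 := by simpa using hy
      simp [this]
    · simp only [Finset.univ_eq_empty, Finset.sum_empty, add_zero]
      rw [Measure.volume_pi_eq_dirac (Fin.elim0 : (i : Fin 0) → ℝ), Measure.map_const]
      simp
  rw [hI.2.2 _ hs _ hm ξ (integrable_dirac (by simp)).integrableOn]
  rw [Measure.restrict_singleton]
  simp

end BV


/-! ### The recursion -/

namespace BV

variable {d : ℕ}

lemma faces_main {Q : Vd d →ₗ[ℝ] Vd d →ₗ[ℝ] ℝ} {Λ Λ' : AddSubgroup (Vd d)}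
    (hΛ : IsFullLattice Λ) (hQ : IsRatInner Λ Q) (hq : IsQuotLattice Q Λ Λ')
    {a : Set (Vd d)} (ha : IsRatAffineCone Λ' a) (hl : ¬ ContainsLine a) :
    ∃ (Fs : Finset (Set (Vd d))) (s : Vd d), (∀ F, F ∈ Fs ↔ IsFaceOf a F) ∧ {s} ∈ Fs ∧
      (∀ s', {s'} ∈ Fs → s' = s) ∧
      (∀ F ∈ Fs, IsRatPolyhedron Λ' F) ∧
      (∀ π, IsQCoproj Q (affineSpan ℝ {s}).direction π →
        AddSubgroup.map π.toAddMonoidHom Λ' = Λ' ∧ π '' suppCone a {s} = a) ∧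
      ∀ F ∈ Fs, F ≠ {s} → ∀ π, IsQCoproj Q (affineSpan ℝ F).direction π →
        rk (AddSubgroup.map π.toAddMonoidHom Λ') < rk Λ' ∧
        IsQuotLattice Q Λ (AddSubgroup.map π.toAddMonoidHom Λ') ∧
        IsRatAffineCone (AddSubgroup.map π.toAddMonoidHom Λ') (π '' suppCone a F) ∧
        ¬ ContainsLine (π '' suppCone a F) ∧
        ∃ N : ℤ, N ≠ 0 ∧ ∀ x ∈ AddSubgroup.map π.toAddMonoidHom Λ', (N : ℝ) • x ∈ Λ' := by
  have hG := good_of_quot hΛ hQ hq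
  obtain ⟨hfin, s, hsa, hsr, hsF, H⟩ := cone_facts hG ha hl
  have hdir : ∀ s : Vd d, (affineSpan ℝ ({s} : Set (Vd d))).direction = ⊥ := by
    intro s; rw [direction_affineSpan, vectorSpan_singleton]
  refine ⟨hfin.toFinset, s, by simp, by simpa using hsF, ?_, ?_, ?_, ?_⟩
  · intro s' hs'
    obtain ⟨_, T, _, h2, h3, _⟩ := H {s'} (by simpa using hs')
    rcases h3 with h3 | ⟨w, hw, hw0⟩
    · simpa using h3
    · exfalso
      apply hw0
      have : w ∈ Submodule.span ℝ (T : Set (Vd d)) := Submodule.subset_span hw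
      rw [← h2, hdir] at this
      simpa using this
  · intro F hF
    exact cone_polyhedron hG.sep (H F (by simpa using hF)).1
  · intro π hπ
    have hid : π = LinearMap.id := by
      apply IsQCoproj_unique hQ.2.1 hπ
      rw [hdir]
      exact ⟨fun x => by simp, fun x y hy => by simp [(Submodule.mem_bot ℝ).1 hy]⟩
    obtain ⟨_, T, _, _, _, h4⟩ := H {s} hsF
    have h5 := (h4 π hπ).1
    subst hid
    constructor
    · ext x; simp
    · simpa using h5
  · intro F hF hne π hπ
    obtain ⟨_, T, h1, h2, h3, h4⟩ := H F (by simpa using hF)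
    obtain ⟨h5, h6, h7⟩ := h4 π hπ
    rw [h2] at hπ
    rw [h5]
    obtain ⟨w, hw, hw0⟩ := h3.resolve_left hne
    exact ⟨rk_lt hQ.2.1 h1 hw hw0 hπ, quot_quot hq T h1 hπ, h6, h7, good_change hG T h1 hπ⟩

lemma sum_split {Fs : Finset (Set (Vd d))} {a : Set (Vd d)} (h : ∀ F, F ∈ Fs ↔ IsFaceOf a F)
    {s : Vd d} (hs : {s} ∈ Fs) (G : Set (Vd d) → ℝ) :
    ∑ᶠ F ∈ {F | IsFaceOf a F}, G F = (open Classical in ∑ F ∈ Fs.erase {s}, G F) + G {s} := by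
  classical
  have : {F | IsFaceOf a F} = (Fs : Set (Set (Vd d))) := by
    ext F; simp [h]
  rw [this, finsum_mem_coe_finset, Finset.sum_erase_add _ _ hs]

open Classical in
/-- a choice of the `Q`-orthogonal projection along `lin F` -/
noncomputable def pF (Q : Vd d →ₗ[ℝ] Vd d →ₗ[ℝ] ℝ) (F : Set (Vd d)) : Vd d →ₗ[ℝ] Vd d :=
  if h : ∃ π, IsQCoproj Q (affineSpan ℝ F).direction π then h.choose else 0

lemma pF_spec {Λ : AddSubgroup (Vd d)} {Q : Vd d →ₗ[ℝ] Vd d →ₗ[ℝ] ℝ} (hQ : IsRatInner Λ Q)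
    (F : Set (Vd d)) : IsQCoproj Q (affineSpan ℝ F).direction (pF Q F) := by
  have h := IsQCoproj_exists hQ.1 hQ.2.1 (affineSpan ℝ F).direction
  unfold pF
  rw [dif_pos h]
  exact h.choose_spec

open Classical in
/-- the vertex of a pointed cone -/
noncomputable def vpt (a : Set (Vd d)) : Vd d :=
  if h : ∃ s, IsFaceOf a {s} then h.choose else 0

lemma vpt_spec {a : Set (Vd d)} (h : ∃ s, IsFaceOf a {s}) : IsFaceOf a {vpt a} := by
  unfold vpt
  rw [dif_pos h]
  exact h.choose_spec

open Classical in
/-- the Berline--Vergne function, by recursion on the rank -/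
noncomputable def mu (Q : Vd d →ₗ[ℝ] Vd d →ₗ[ℝ] ℝ)
    (I S : AddSubgroup (Vd d) → Set (Vd d) → Vd d → ℝ) (Λ : AddSubgroup (Vd d))
    (a : Set (Vd d)) (ξ : Vd d) : ℝ :=
  (S Λ a ξ - ∑ᶠ F ∈ {F | IsFaceOf a F},
    (if _h : rk (AddSubgroup.map (pF Q F).toAddMonoidHom Λ) < rk Λ then
      mu Q I S (AddSubgroup.map (pF Q F).toAddMonoidHom Λ) (pF Q F '' suppCone a F) ξ * I Λ F ξ
    else 0)) / I Λ {vpt a} ξ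
termination_by rk Λ

open Classical in
lemma mu_eq {Q : Vd d →ₗ[ℝ] Vd d →ₗ[ℝ] ℝ} {Λ Λ' : AddSubgroup (Vd d)}
    (hQ : IsRatInner Λ Q) (I S : AddSubgroup (Vd d) → Set (Vd d) → Vd d → ℝ)
    {a : Set (Vd d)} {Fs : Finset (Set (Vd d))} {s : Vd d}
    (h1 : ∀ F, F ∈ Fs ↔ IsFaceOf a F) (h2 : {s} ∈ Fs) (h3 : ∀ s', {s'} ∈ Fs → s' = s)
    (h5 : ∀ π, IsQCoproj Q (affineSpan ℝ {s}).direction π →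
        AddSubgroup.map π.toAddMonoidHom Λ' = Λ' ∧ π '' suppCone a {s} = a)
    (h6 : ∀ F ∈ Fs, F ≠ {s} → rk (AddSubgroup.map (pF Q F).toAddMonoidHom Λ') < rk Λ')
    (ξ : Vd d) :
    mu Q I S Λ' a ξ = (S Λ' a ξ - ∑ F ∈ Fs.erase {s},
      mu Q I S (AddSubgroup.map (pF Q F).toAddMonoidHom Λ') (pF Q F '' suppCone a F) ξ
        * I Λ' F ξ) / I Λ' {s} ξ := by
  have hv : vpt a = s := h3 _ ((h1 _).2 (vpt_spec ⟨s, (h1 _).1 h2⟩))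
  rw [mu, hv, sum_split h1 h2, (h5 _ (pF_spec hQ _)).1, dif_neg (lt_irrefl _), add_zero]
  congr 2
  apply Finset.sum_congr rfl
  intro F hF
  rw [Finset.mem_erase] at hF
  rw [dif_pos (h6 F hF.2 hF.1)]

lemma MeroEq_closure {f g : Vd d → ℝ} (h : MeroEqAt0 f g) :
    ∃ Z : Set (Vd d), IsClosed Z ∧ interior Z = ∅ ∧
    ∀ᶠ ξ in 𝓝 (0 : Vd d), ξ ∉ Z → f ξ = g ξ := h

lemma bad_union {Z W : Set (Vd d)} (h1 : IsClosed Z) (h2 : interior Z = ∅)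
    (h4 : interior W = ∅) : interior (Z ∪ W) = ∅ := by
  rw [interior_union_isClosed_of_interior_empty h1 h4, h2]

lemma mero_all {ι : Type*} (s : Finset ι) (f g : ι → Vd d → ℝ)
    (h : ∀ i ∈ s, MeroEqAt0 (f i) (g i)) : ∃ Z : Set (Vd d), IsClosed Z ∧ interior Z = ∅ ∧
      ∀ᶠ ξ in 𝓝 (0 : Vd d), ξ ∉ Z → ∀ i ∈ s, f i ξ = g i ξ := by
  classical
  induction s using Finset.induction_on with
  | empty => exact ⟨∅, isClosed_empty, by simp, by simp⟩
  | insert a s ha ih =>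
    obtain ⟨Z, z1, z2, z3⟩ := ih fun i hi => h i (by simp [hi])
    obtain ⟨W, w1, w2, w3⟩ := h a (by simp)
    refine ⟨Z ∪ W, z1.union w1, bad_union z1 z2 w2, ?_⟩
    filter_upwards [z3, w3] with ξ hz hw hn i hi
    rw [Set.mem_union, not_or] at hn
    rcases Finset.mem_insert.1 hi with rfl | hi
    · exact hw hn.2
    · exact hz hn.1 i hi

lemma quot_bot {Q : Vd d →ₗ[ℝ] Vd d →ₗ[ℝ] ℝ} {Λ : AddSubgroup (Vd d)}
    (hΛ : IsFullLattice Λ) : IsQuotLattice Q Λ ⊥ := by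
  refine ⟨⊤, 0, ?_, ⟨by simp, by simp⟩, ?_⟩
  · simpa using hΛ.2
  · ext x
    rw [AddSubgroup.mem_bot, AddSubgroup.mem_map]
    constructor
    · rintro rfl; exact ⟨0, zero_mem _, by simp⟩
    · rintro ⟨y, _, rfl⟩; rfl

lemma existence {Q : Vd d →ₗ[ℝ] Vd d →ₗ[ℝ] ℝ} {Λ : AddSubgroup (Vd d)}
    (hΛ : IsFullLattice Λ) (hQ : IsRatInner Λ Q)
    {I S : AddSubgroup (Vd d) → Set (Vd d) → Vd d → ℝ}
    (hI : IsIFamily Q Λ I) (hS : IsSFamily Q Λ S) : IsMuCore Λ Q I S (mu Q I S) := by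
  classical
  refine ⟨?_, ?_, ?_⟩
  · intro Λ'
    induction hn : rk Λ' using Nat.strong_induction_on generalizing Λ' with
    | _ n ih =>
    intro hq a ha hl
    obtain ⟨Fs, s, h1, h2, h3, h4, h5, h6⟩ := faces_main hΛ hQ hq ha hl
    have e : mu Q I S Λ' a = _ := funext (mu_eq hQ I S h1 h2 h3 h5
      (fun F hF hne => (h6 F hF hne _ (pF_spec hQ F)).1))
    rw [e]
    have hG := good_of_quot hΛ hQ hq
    have hs : RatMeromorphicAt0 Λ' (S Λ' a) := (hS Λ' hq).1 _ (cone_polyhedron hG.sep ha)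
    have hinv := mero_inv ((hI Λ' hq).1 _ (h4 _ h2)) (fun ξ => by
      rw [I_point (hI Λ' hq) (h4 _ h2)]; exact (Real.exp_pos _).ne')
    simp only [div_eq_mul_inv]
    apply mero_mul (mero_sub hs _) hinv
    apply mero_sum
    intro F hF
    rw [Finset.mem_erase] at hF
    obtain ⟨k1, k2, k3, k4, N, hN, k5⟩ := h6 F hF.2 hF.1 _ (pF_spec hQ F)
    exact mero_mul (mero_change N hN k5 (ih _ (hn ▸ k1) _ rfl k2 _ k3 k4))
      ((hI Λ' hq).1 _ (h4 _ hF.2))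
  · intro ξ
    have hq : IsQuotLattice Q Λ ⊥ := quot_bot hΛ
    have hG := good_of_quot hΛ hQ hq
    have hcone : IsRatAffineCone (⊥ : AddSubgroup (Vd d)) ({0} : Set (Vd d)) :=
      ⟨0, 0, Fin.elim0, ratpt_of_mem (zero_mem _), fun i => i.elim0, by ext x; simp⟩
    have hp := cone_polyhedron hG.sep hcone
    have hface : IsFaceOf ({0} : Set (Vd d)) {0} :=
      ⟨⟨0, rfl⟩, 0, by ext x; simp +contextual⟩
    have hv : vpt ({0} : Set (Vd d)) = 0 := by
      obtain ⟨_, φ, h⟩ := vpt_spec ⟨0, hface⟩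
      have : vpt ({0} : Set (Vd d)) ∈ ({vpt ({0} : Set (Vd d))} : Set (Vd d)) := rfl
      rw [h] at this
      exact this.1
    have hrk : rk (⊥ : AddSubgroup (Vd d)) = 0 := by
      unfold rk
      have : Submodule.span ℝ ((⊥ : AddSubgroup (Vd d)) : Set (Vd d)) = ⊥ := by simp
      rw [this]; simp
    have hSv : S ⊥ {0} ξ = 1 := by
      have hset : ({0} : Set (Vd d)) ∩ ((⊥ : AddSubgroup (Vd d)) : Set (Vd d)) = {0} := by simp
      have hfin : Finite ↥(({0} : Set (Vd d)) ∩ ((⊥ : AddSubgroup (Vd d)) : Set (Vd d))) := by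
        rw [hset]; infer_instance
      rw [(hS ⊥ hq).2.2 _ hp ξ (summable_of_finite_support (Set.toFinite _))]
      rw [hset, tsum_singleton 0 (fun x : Vd d => Real.exp (pairE ξ x))]
      simp [pairE]
    rw [mu, hv, I_point (hI ⊥ hq) hp, hSv]
    simp [hrk, pairE]
  · intro Λ' hq a ha hl π hπ
    obtain ⟨Fs, s, h1, h2, h3, h4, h5, h6⟩ := faces_main hΛ hQ hq ha hl
    refine ⟨∅, isClosed_empty, by simp, Filter.Eventually.of_forall fun ξ _ => ?_⟩
    refine Eq.trans ?_ (sum_split h1 h2 (fun F => mu Q I S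
      (AddSubgroup.map (π F).toAddMonoidHom Λ') (π F '' suppCone a F) ξ * I Λ' F ξ)).symm
    beta_reduce
    obtain ⟨e1, e2⟩ := h5 _ (hπ _ ((h1 _).1 h2))
    rw [e1, e2, mu_eq hQ I S h1 h2 h3 h5
      (fun F hF hne => (h6 F hF hne _ (pF_spec hQ F)).1) ξ]
    have hne : I Λ' {s} ξ ≠ 0 := by
      rw [I_point (hI Λ' hq) (h4 _ h2)]; exact (Real.exp_pos _).ne'
    rw [div_mul_cancel₀ _ hne]
    have : ∀ F ∈ Fs.erase {s}, π F = pF Q F := fun F hF =>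
      IsQCoproj_unique hQ.2.1 (hπ F ((h1 F).1 (Finset.mem_of_mem_erase hF))) (pF_spec hQ F)
    rw [Finset.sum_congr rfl (fun F hF => by rw [this F hF])]
    ring

lemma uniqueness {Q : Vd d →ₗ[ℝ] Vd d →ₗ[ℝ] ℝ} {Λ : AddSubgroup (Vd d)}
    (hΛ : IsFullLattice Λ) (hQ : IsRatInner Λ Q)
    {I S : AddSubgroup (Vd d) → Set (Vd d) → Vd d → ℝ}
    (hI : IsIFamily Q Λ I)
    {μ₁ μ₂ : AddSubgroup (Vd d) → Set (Vd d) → Vd d → ℝ}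
    (hμ₁ : IsMuCore Λ Q I S μ₁) (hμ₂ : IsMuCore Λ Q I S μ₂) :
    ∀ Λ' a, IsQuotLattice Q Λ Λ' → IsRatAffineCone Λ' a → ¬ ContainsLine a →
        MeroEqAt0 (μ₁ Λ' a) (μ₂ Λ' a) := by
  classical
  intro Λ'
  induction hn : rk Λ' using Nat.strong_induction_on generalizing Λ' with
  | _ n ih =>
  intro a hq ha hl
  obtain ⟨Fs, s, h1, h2, h3, h4, h5, h6⟩ := faces_main hΛ hQ hq ha hl
  obtain ⟨Z, z1, z2, z3⟩ := hμ₁.2.2 Λ' hq a ha hl (pF Q) (fun F _ => pF_spec hQ F)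
  obtain ⟨W, w1, w2, w3⟩ := hμ₂.2.2 Λ' hq a ha hl (pF Q) (fun F _ => pF_spec hQ F)
  obtain ⟨Y, y1, y2, y3⟩ := mero_all (Fs.erase {s})
    (fun F => μ₁ (AddSubgroup.map (pF Q F).toAddMonoidHom Λ') (pF Q F '' suppCone a F))
    (fun F => μ₂ (AddSubgroup.map (pF Q F).toAddMonoidHom Λ') (pF Q F '' suppCone a F))
    (fun F hF => by
      rw [Finset.mem_erase] at hF
      obtain ⟨k1, k2, k3, k4, _⟩ := h6 F hF.2 hF.1 _ (pF_spec hQ F)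
      exact ih _ (hn ▸ k1) _ rfl _ k2 k3 k4)
  refine ⟨Z ∪ (W ∪ Y), z1.union (w1.union y1), bad_union z1 z2 (bad_union w1 w2 y2), ?_⟩
  filter_upwards [z3, w3, y3] with ξ hz hw hy hn
  simp only [Set.mem_union, not_or] at hn
  have hz := (hz hn.1).trans (sum_split h1 h2 (fun F => μ₁
    (AddSubgroup.map (pF Q F).toAddMonoidHom Λ') (pF Q F '' suppCone a F) ξ * I Λ' F ξ))
  have hw := (hw hn.2.1).trans (sum_split h1 h2 (fun F => μ₂
    (AddSubgroup.map (pF Q F).toAddMonoidHom Λ') (pF Q F '' suppCone a F) ξ * I Λ' F ξ))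
  have hy := hy hn.2.2
  beta_reduce at hz hw
  obtain ⟨e1, e2⟩ := h5 _ (pF_spec hQ _)
  rw [e1, e2] at hz hw
  have hne : I Λ' {s} ξ ≠ 0 := by
    rw [I_point (hI Λ' hq) (h4 _ h2)]; exact (Real.exp_pos _).ne'
  rw [hz, Finset.sum_congr rfl (fun F hF => by rw [hy F hF]), add_right_inj] at hw
  exact mul_right_cancel₀ hne hw

end BV


/-- given a rational scalar product `Q` on `(V,Λ)` and the maps `I`, `S` on the
rational quotient spaces of `V`, there exists a family `μ` indexed by the rational quotient
lattices, assigning to pointed rational affine cones meromorphic functions with rational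
coefficients near `0`, with `μ_{0}({0}) = 1` and satisfying
`S(a) = ∑_{f ∈ F(a)} μ(t(a,f)) I(f)` (functions on quotient duals being extended by
`Q`-orthogonal projection); moreover such a family is unique (as meromorphic germs). -/
theorem statement6 (d : ℕ) (Λ : AddSubgroup (Vd d)) (hΛ : IsFullLattice Λ)
    (Q : Vd d →ₗ[ℝ] Vd d →ₗ[ℝ] ℝ) (hQ : IsRatInner Λ Q)
    (I S : AddSubgroup (Vd d) → Set (Vd d) → Vd d → ℝ)
    (hI : IsIFamily Q Λ I) (hS : IsSFamily Q Λ S) :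
    (∃ μ : AddSubgroup (Vd d) → Set (Vd d) → Vd d → ℝ, IsMuCore Λ Q I S μ) ∧
    (∀ μ₁ μ₂ : AddSubgroup (Vd d) → Set (Vd d) → Vd d → ℝ,
      IsMuCore Λ Q I S μ₁ → IsMuCore Λ Q I S μ₂ →
      ∀ Λ' a, IsQuotLattice Q Λ Λ' → IsRatAffineCone Λ' a → ¬ ContainsLine a →
        MeroEqAt0 (μ₁ Λ' a) (μ₂ Λ' a)) := by
  exact ⟨⟨BV.mu Q I S, BV.existence hΛ hQ hI hS⟩,
    fun μ₁ μ₂ h₁ h₂ => BV.uniqueness hΛ hQ hI h₁ h₂⟩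
end

section
/- Let t ∈ ℚ with 0 ≤ t < 1. In dimension 1 (V = ℝ with lattice ℤ), μ(−t + ℝ₊)(ξ) = e^{tξ}/(1−e^ξ) + 1/ξ, and its Taylor expansion at 0 is μ(−t+ℝ₊)(ξ) = − Σ_{n≥0} (b(n+1,t)/(n+1)!) ξ^n, where b(n,t) are the Bernoulli polynomials defined by Σ_{n≥0} b(n,t) X^n / n! = e^{tX} X/(e^X − 1). More generally, for a rational half-line a in V containing integral points, if a − a₀ = (−t + ℝ₊) v for some integral point a₀ ∈ a, a primitive integral vector v, and t ∈ [0,1[, then μ(a)(ξ) = e^{t⟨ξ,v⟩}/(1−e^{⟨ξ,v⟩}) + 1/⟨ξ,v⟩. -/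
open MeasureTheory Filter Topology Set
open scoped RealInnerProductSpace Pointwise BigOperators

theorem HasSum.congr_fun_val {f g : ℕ → ℝ} {a b : ℝ} (h : HasSum g b) (hf : ∀ n, f n = g n)
    (hab : a = b) : HasSum f a := by
  rw [hab, funext hf]; exact h

theorem bern_bound : ∃ C : ℝ, ∀ k : ℕ, 2 ≤ k → ∀ x ∈ Set.Icc (0:ℝ) 1,
    |bernoulliFun k x / (k.factorial : ℝ)| ≤ C := by
  have hsum : Summable (fun n : ℤ => ‖1 / (n:ℝ) ^ 2‖) :=
    (Real.summable_one_div_int_pow.mpr (by norm_num : 1 < 2)).norm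
  refine ⟨∑' n : ℤ, ‖1 / (n:ℝ) ^ 2‖, fun k hk x hx => ?_⟩
  have h := hasSum_one_div_pow_mul_fourier_mul_bernoulliFun hk hx
  have hle : ∀ n : ℤ, ‖(1 / (n:ℂ) ^ k * (fourier n) (x : UnitAddCircle) : ℂ)‖ ≤ ‖1 / (n:ℝ) ^ 2‖ := by
    intro n
    rw [norm_mul, fourier_apply, Circle.norm_coe, mul_one]
    rcases eq_or_ne n 0 with rfl | hn
    · have : k ≠ 0 := by omega
      simp [this]
    · rw [norm_div, norm_div, norm_pow, norm_pow, Complex.norm_intCast, norm_one, norm_one, Real.norm_eq_abs]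
      have h1 : (1:ℝ) ≤ |(n:ℝ)| := by exact_mod_cast Int.one_le_abs hn
      have := pow_le_pow_right₀ h1 hk
      gcongr
  have h2 := tsum_of_norm_bounded hsum.hasSum hle
  rw [h.tsum_eq] at h2
  refine le_trans ?_ h2
  rw [norm_mul, norm_div, norm_neg, norm_pow, Complex.norm_natCast, Complex.norm_real, Real.norm_eq_abs,
    abs_div, Nat.abs_cast]
  have h3 : (1:ℝ) ≤ ‖(2 * Real.pi * Complex.I : ℂ)‖ := by
    simp [abs_of_pos Real.pi_pos]
    nlinarith [Real.pi_gt_three]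
  have h4 : (1:ℝ) ≤ ‖(2 * Real.pi * Complex.I : ℂ)‖ ^ k := one_le_pow₀ h3
  rw [div_mul_eq_mul_div]
  gcongr
  nlinarith [abs_nonneg (bernoulliFun k x)]

theorem bern_hasSum (t : ℚ) (h0 : 0 ≤ t) (h1 : t < 1) (y : ℝ) (hy : y ≠ 0) (hy1 : |y| < 1) :
    HasSum
          (fun n : ℕ =>
            ((-(Polynomial.eval t (Polynomial.bernoulli (n + 1)) /
                (Nat.factorial (n + 1) : ℚ)) : ℚ) : ℝ) * y ^ n)
          (Real.exp ((t : ℝ) * y) / (1 - Real.exp y) + 1 / y) := by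
  have hexp : ∀ z : ℝ, HasSum (fun n : ℕ => z ^ n / (n.factorial : ℝ)) (Real.exp z) := by
    intro z
    have := NormedSpace.expSeries_div_hasSum_exp z
    rwa [← Real.exp_eq_exp_ℝ] at this
  obtain ⟨C, hC⟩ := bern_bound
  set f : ℕ → ℝ := fun n => bernoulliFun n t / (n.factorial : ℝ) * y ^ n with hf
  have htI : (t:ℝ) ∈ Set.Icc (0:ℝ) 1 := ⟨by exact_mod_cast h0, by exact_mod_cast h1.le⟩
  have hfs : Summable (fun n => ‖f n‖) := by
    rw [← summable_nat_add_iff 2]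
    refine Summable.of_nonneg_of_le (fun n => norm_nonneg _) (fun n => ?_)
      ((summable_nat_add_iff 2).mpr ((summable_geometric_of_lt_one (abs_nonneg y) hy1).mul_left C))
    rw [hf, norm_mul, Real.norm_eq_abs, norm_pow, Real.norm_eq_abs]
    gcongr
    exact hC _ (by omega) _ htI
  set g : ℕ → ℝ := fun n => if n = 0 then 0 else y ^ n / (n.factorial : ℝ) with hg
  have hgsum : HasSum g (Real.exp y - 1) := by
    have := (hexp y).sub (hasSum_ite_eq (0:ℕ) (1:ℝ))
    have e : g = fun b : ℕ => y ^ b / (b.factorial : ℝ) - if b = 0 then 1 else 0 := by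
      funext n
      rcases eq_or_ne n 0 with rfl | hn <;> simp [*]
    rw [e]
    exact this
  have hgs : Summable (fun n => ‖g n‖) := hgsum.summable.norm
  have hprod := tsum_mul_tsum_eq_tsum_sum_antidiagonal_of_summable_norm hfs hgs
  have hbf : ∀ n, bernoulliFun n t = ((Polynomial.eval t (Polynomial.bernoulli n) : ℚ) : ℝ) := by
    intro n
    have := Polynomial.eval_map_apply (algebraMap ℚ ℝ) t (p := Polynomial.bernoulli n)
    simpa [bernoulliFun] using this
  have hcoef : ∀ n, ∑ kl ∈ Finset.HasAntidiagonal.antidiagonal n, f kl.1 * g kl.2 =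
      if n = 0 then 0 else y * ((t * y) ^ (n-1) / ((n-1).factorial : ℝ)) := by
    intro n
    have h := congrArg (PowerSeries.coeff n) (Polynomial.bernoulli_generating_function (A := ℝ) (t:ℝ))
    rw [PowerSeries.coeff_mul] at h
    have h2 : ∑ kl ∈ Finset.HasAntidiagonal.antidiagonal n, f kl.1 * g kl.2 = y ^ n *
      PowerSeries.coeff n (PowerSeries.X * (PowerSeries.rescale (t:ℝ)) (PowerSeries.exp ℝ)) := by
      rw [← h, Finset.mul_sum]
      refine Finset.sum_congr rfl fun kl hkl => ?_
      rw [Finset.HasAntidiagonal.mem_antidiagonal] at hkl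
      rw [← hkl, pow_add]
      have e1 : PowerSeries.coeff kl.1 (PowerSeries.mk fun n => (Polynomial.aeval (t:ℝ)) ((1 / (n.factorial:ℚ)) • Polynomial.bernoulli n)) = bernoulliFun kl.1 t / (kl.1.factorial : ℝ) := by
        rw [PowerSeries.coeff_mk, map_smul, bernoulliFun, Polynomial.aeval_def, Polynomial.eval_map, Rat.smul_def]
        push_cast
        ring
      have e2 : y ^ kl.2 * PowerSeries.coeff kl.2 (PowerSeries.exp ℝ - 1) = g kl.2 := by
        rw [map_sub, PowerSeries.coeff_exp, PowerSeries.coeff_one]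
        rcases eq_or_ne kl.2 0 with hk | hn
        · simp [hg, hk]
        · simp [hg, hn, div_eq_mul_inv]
      rw [e1, ← e2]
      simp only [hf]
      ring
    rw [h2]
    rcases n with _ | n
    · simp
    · rw [PowerSeries.coeff_succ_X_mul, PowerSeries.coeff_rescale, PowerSeries.coeff_exp]
      simp [mul_pow, pow_succ]
      ring
  have hR : HasSum (fun n : ℕ => if n = 0 then (0:ℝ) else y * ((t * y) ^ (n-1) / ((n-1).factorial : ℝ))) (y * Real.exp (t * y)) := by
    rw [← hasSum_nat_add_iff' 1]
    simpa using (hexp (t * y)).mul_left y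
  simp_rw [hcoef] at hprod
  rw [hR.tsum_eq, hgsum.tsum_eq] at hprod
  have hfS : HasSum f (∑' n, f n) := hfs.of_norm.hasSum
  rw [← hasSum_nat_add_iff' 1] at hfS
  have := hfS.mul_left (-(1/y))
  have hne : Real.exp y - 1 ≠ 0 := by
    intro h
    exact hy (by rwa [sub_eq_zero, Real.exp_eq_one_iff] at h)
  refine (HasSum.congr_fun_val this ?_ ?_)
  · intro n
    simp only [hf]
    rw [hbf]
    push_cast
    field_simp
    ring
  · rw [eq_div_of_mul_eq hne hprod]
    have hne' : 1 - Real.exp y ≠ 0 := by intro h; apply hne; linarith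
    have f0 : f 0 = 1 := by simp [hf, bernoulliFun]
    simp [f0]
    rw [← neg_sub (Real.exp y) 1]
    field_simp
    ring

theorem part1 : ∀ t : ℚ, 0 ≤ t → t < 1 →
      ∀ᶠ y in nhdsWithin (0 : ℝ) {y : ℝ | y ≠ 0},
        HasSum
          (fun n : ℕ =>
            ((-(Polynomial.eval t (Polynomial.bernoulli (n + 1)) /
                (Nat.factorial (n + 1) : ℚ)) : ℚ) : ℝ) * y ^ n)
          (Real.exp ((t : ℝ) * y) / (1 - Real.exp y) + 1 / y) := by
  intro t h0 h1
  have hb : ∀ᶠ y in 𝓝 (0:ℝ), |y| < 1 := by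
    filter_upwards [Metric.ball_mem_nhds (0:ℝ) one_pos] with y hy
    simpa using hy
  filter_upwards [nhdsWithin_le_nhds hb, self_mem_nhdsWithin] with y h2 h3
  exact bern_hasSum t h0 h1 y h3 h2

def NearGen {d : ℕ} (P : Vd d → Prop) : Prop :=
  ∃ Z : Set (Vd d), IsClosed Z ∧ interior Z = ∅ ∧ ∀ᶠ ξ in 𝓝 (0 : Vd d), ξ ∉ Z → P ξ

theorem NearGen.mp2 {d : ℕ} {P P' R : Vd d → Prop} (h1 : NearGen P) (h2 : NearGen P')
    (h : ∀ ξ, P ξ → P' ξ → R ξ) : NearGen R := by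
  obtain ⟨Z, a1, a2, a3⟩ := h1
  obtain ⟨W, b1, b2, b3⟩ := h2
  refine ⟨Z ∪ W, a1.union b1, ?_, ?_⟩
  · rw [interior_union_isClosed_of_interior_empty a1 b2, a2]
  · filter_upwards [a3, b3] with ξ c1 c2 hξ
    simp only [mem_union, not_or] at hξ
    exact h ξ (c1 hξ.1) (c2 hξ.2)

theorem pairE_analytic {d : ℕ} (x : Vd d) : AnalyticOnNhd ℝ (fun ξ : Vd d => pairE ξ x) univ := by
  have : (fun ξ : Vd d => pairE ξ x) = fun ξ => innerSL ℝ x ξ := by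
    funext ξ
    simp only [pairE, innerSL_apply_apply]
    exact real_inner_comm _ _
  rw [this]
  exact (innerSL ℝ x).analyticOnNhd _

theorem pairE_cont {d : ℕ} (x : Vd d) : Continuous (fun ξ : Vd d => pairE ξ x) := by
  unfold pairE
  fun_prop

theorem pairE_cont2 {d : ℕ} (x : Vd d) : Continuous (fun ξ : Vd d => pairE x ξ) := by
  unfold pairE
  fun_prop

theorem pairE_add {d : ℕ} (ξ x y : Vd d) : pairE ξ (x + y) = pairE ξ x + pairE ξ y := inner_add_right _ _ _

theorem pairE_smul {d : ℕ} (ξ x : Vd d) (r : ℝ) : pairE ξ (r • x) = r * pairE ξ x := inner_smul_right _ _ _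

theorem pairE_smul_left {d : ℕ} (ξ x : Vd d) (r : ℝ) : pairE (r • ξ) x = r * pairE ξ x :=
  real_inner_smul_left _ _ _

theorem pairE_self_pos {d : ℕ} {v : Vd d} (hv : v ≠ 0) : 0 < pairE v v := real_inner_self_pos.mpr hv

theorem nearGen_line {d : ℕ} {v : Vd d} (hv : v ≠ 0) : NearGen (fun ξ => pairE ξ v ≠ 0) := by
  refine ⟨{ξ | pairE ξ v = 0}, isClosed_eq (pairE_cont v) continuous_const, ?_, ?_⟩
  · rw [Set.eq_empty_iff_forall_notMem]
    intro z hz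
    have h := (pairE_analytic v).eqOn_of_preconnected_of_eventuallyEq (g := fun _ => 0)
      analyticOnNhd_const isPreconnected_univ (mem_univ z)
      (by filter_upwards [mem_interior_iff_mem_nhds.mp hz] with ξ hξ using hξ)
    exact (pairE_self_pos hv).ne' (h (mem_univ v))
  · exact Eventually.of_forall fun ξ h => h

theorem mero_ext {d : ℕ} {Λ : AddSubgroup (Vd d)} {f G H : Vd d → ℝ} {v : Vd d} (hv : v ≠ 0)
    (hf : RatMeromorphicAt0 Λ f) (hG : AnalyticOnNhd ℝ G univ) (hH : AnalyticOnNhd ℝ H univ)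
    (hfG : ∀ ξ, pairE ξ v < 0 → f ξ * H ξ = G ξ) : NearGen (fun ξ => f ξ * H ξ = G ξ) := by
  obtain ⟨g, h, ⟨p, hp, -⟩, ⟨q, hq, -⟩, hnz, hfe⟩ := hf
  have hall := (hp.analyticAt.eventually_analyticAt.and hq.analyticAt.eventually_analyticAt).and hfe
  obtain ⟨r, hr, hball⟩ := Metric.eventually_nhds_iff_ball.mp hall
  have hga : AnalyticOnNhd ℝ g (Metric.ball 0 r) := fun x hx => (hball x hx).1.1
  have hha : AnalyticOnNhd ℝ h (Metric.ball 0 r) := fun x hx => (hball x hx).1.2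
  have hpre : IsPreconnected (Metric.ball (0 : Vd d) r) := (convex_ball _ _).isPreconnected
  have hzero : ∀ z ∈ Metric.ball (0 : Vd d) r, ¬ ∀ᶠ ξ in 𝓝 z, h ξ = 0 := by
    intro z hz hev
    have := hha.eqOn_of_preconnected_of_eventuallyEq (g := fun _ => 0) analyticOnNhd_const hpre hz hev
    apply hnz
    filter_upwards [Metric.ball_mem_nhds (0 : Vd d) hr] with ξ hξ using this hξ
  have hopen : IsOpen {ξ : Vd d | pairE ξ v < 0} := isOpen_lt (pairE_cont v) continuous_const
  obtain ⟨z, hzb, hzn⟩ : ∃ z ∈ Metric.ball (0 : Vd d) r, pairE z v < 0 := by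
    refine ⟨(-(r / (2 * ‖v‖))) • v, ?_, ?_⟩
    · have : 0 < ‖v‖ := norm_pos_iff.mpr hv
      rw [mem_ball_zero_iff, norm_smul, norm_neg, Real.norm_of_nonneg (by positivity)]
      field_simp
      linarith
    · have : 0 < ‖v‖ := norm_pos_iff.mpr hv
      rw [pairE_smul_left]
      have h2 := pairE_self_pos hv
      have : 0 < r / (2 * ‖v‖) := by positivity
      nlinarith
  have hzev : ∀ᶠ ξ in 𝓝 z, ξ ∈ Metric.ball (0 : Vd d) r ∧ pairE ξ v < 0 :=
    Filter.inter_mem (Metric.isOpen_ball.mem_nhds hzb) (hopen.mem_nhds hzn)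
  obtain ⟨w, ⟨hwb, hwn⟩, hw⟩ : ∃ w, (w ∈ Metric.ball (0 : Vd d) r ∧ pairE w v < 0) ∧ h w ≠ 0 := by
    by_contra hcon
    push Not at hcon
    exact hzero z hzb (hzev.mono fun ξ hξ => hcon ξ hξ)
  have hwev : (fun ξ => g ξ * H ξ) =ᶠ[𝓝 w] (fun ξ => h ξ * G ξ) := by
    filter_upwards [Metric.isOpen_ball.mem_nhds hwb, hopen.mem_nhds hwn,
      (hha w hwb).continuousAt.eventually_ne hw] with ξ h1 h2 h3
    rw [← (hball ξ h1).2 h3, ← hfG ξ h2]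
    ring
  have heq := (hga.mul (hH.mono (subset_univ _))).eqOn_of_preconnected_of_eventuallyEq
    (hha.mul (hG.mono (subset_univ _))) hpre hwb hwev
  have hsub : Metric.closedBall (0 : Vd d) (r / 2) ⊆ Metric.ball 0 r :=
    Metric.closedBall_subset_ball (by linarith)
  refine ⟨Metric.closedBall 0 (r / 2) ∩ h ⁻¹' {0}, ?_, ?_, ?_⟩
  · exact (hha.continuousOn.mono hsub).preimage_isClosed_of_isClosed Metric.isClosed_closedBall
      isClosed_singleton
  · rw [Set.eq_empty_iff_forall_notMem]
    intro y hy
    have hyb := hsub (interior_subset hy).1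
    refine hzero y hyb ?_
    filter_upwards [mem_interior_iff_mem_nhds.mp hy] with ξ hξ using hξ.2
  · filter_upwards [Metric.closedBall_mem_nhds (0 : Vd d) (half_pos hr)] with ξ hξ hnot
    have h1 : h ξ ≠ 0 := fun h0 => hnot ⟨hξ, h0⟩
    have h2 := (hball ξ (hsub hξ)).2 h1
    have h3 : g ξ * H ξ = h ξ * G ξ := heq (hsub hξ)
    apply mul_left_cancel₀ h1
    rw [← h3, ← h2]
    ring

theorem exists_vec {d : ℕ} (l : Vd d →ₗ[ℝ] ℝ) : ∃ φ : Vd d, ∀ x, pairE φ x = l x := by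
  refine ⟨(InnerProductSpace.toDual ℝ (Vd d)).symm (LinearMap.toContinuousLinearMap l), fun x => ?_⟩
  unfold pairE
  rw [InnerProductSpace.toDual_symm_apply]
  rfl

theorem lat_coords {d : ℕ} {Λ : AddSubgroup (Vd d)} (hΛ : IsFullLattice Λ) :
    ∃ (k : ℕ) (l : Fin k → Vd d →ₗ[ℝ] ℝ), (∀ i, ∀ x ∈ Λ, ∃ n : ℤ, l i x = n) ∧
      ∀ x, (∀ i, l i x = 0) → x = 0 := by
  obtain ⟨⟨k, b, hb, rfl⟩, hspan⟩ := hΛ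
  have htop : ⊤ ≤ Submodule.span ℝ (Set.range b) := by
    rw [← hspan, Submodule.span_le]
    intro x hx
    have : AddSubgroup.closure (Set.range b) ≤ (Submodule.span ℝ (Set.range b)).toAddSubgroup := by
      rw [AddSubgroup.closure_le]
      exact Submodule.subset_span
    exact this hx
  let B := Module.Basis.mk hb htop
  refine ⟨k, fun i => B.coord i, ?_, ?_⟩
  · intro i x hx
    induction hx using AddSubgroup.closure_induction with
    | mem x hx =>
      obtain ⟨j, rfl⟩ := hx
      have : b j = B j := by simp [B]
      rw [this, Module.Basis.coord_apply, B.repr_self]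
      by_cases h : j = i
      · exact ⟨1, by simp [h]⟩
      · exact ⟨0, by simp [h]⟩
    | zero => exact ⟨0, by simp⟩
    | add x y _ _ hx hy =>
      obtain ⟨m, hm⟩ := hx
      obtain ⟨n, hn⟩ := hy
      exact ⟨m + n, by rw [map_add, hm, hn]; push_cast; ring⟩
    | neg x _ hx =>
      obtain ⟨m, hm⟩ := hx
      exact ⟨-m, by rw [map_neg, hm]; push_cast; ring⟩
  · intro x hx
    exact B.forall_coord_eq_zero_iff.mp hx

theorem ratpoly_of {d : ℕ} {Λ : AddSubgroup (Vd d)} {ι : Type} [Fintype ι] (l : ι → Vd d →ₗ[ℝ] ℝ)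
    (c : ι → ℚ) (hl : ∀ i, ∀ x ∈ Λ, ∃ n : ℤ, l i x = n) :
    IsRatPolyhedron Λ {x | x ∈ Submodule.span ℝ (Λ : Set (Vd d)) ∧ ∀ i, l i x ≤ (c i : ℝ)} := by
  choose φ hφ using fun i => exists_vec (l i)
  let e := (Fintype.equivFin ι).symm
  refine ⟨Fintype.card ι, fun i => φ (e i), fun i => c (e i), ?_, ?_⟩
  · intro i x hx
    simp only [hφ]
    exact hl _ x hx
  · ext x
    simp only [hφ, mem_ofPred_eq]
    refine and_congr_right fun _ => ⟨fun h i => h _, fun h i => ?_⟩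
    have := h (e.symm i)
    simpa using this

theorem ratpoly {d : ℕ} {Λ : AddSubgroup (Vd d)} {k : ℕ} (E : Fin k → Vd d →ₗ[ℝ] ℝ) (p : Vd d)
    (L : Vd d →ₗ[ℝ] ℝ) (c : ℚ) (hE : ∀ i, ∀ x ∈ Λ, ∃ n : ℤ, E i x = n)
    (hp : ∀ i, ∃ q : ℚ, E i p = q) (hL : ∀ x ∈ Λ, ∃ n : ℤ, L x = n) :
    IsRatPolyhedron Λ {x | x ∈ Submodule.span ℝ (Λ : Set (Vd d)) ∧ (∀ i, E i x = E i p) ∧ L x ≤ c} := by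
  choose q hq using hp
  have := ratpoly_of (Λ := Λ) (ι := (Fin k ⊕ Fin k) ⊕ Unit)
    (Sum.elim (Sum.elim E (fun i => -E i)) (fun _ => L))
    (Sum.elim (Sum.elim q (fun i => -q i)) (fun _ => c)) (by
      rintro ((i | i) | i) x hx
      · exact hE i x hx
      · obtain ⟨n, hn⟩ := hE i x hx
        exact ⟨-n, by simp [hn]⟩
      · exact hL x hx)
  convert this using 1
  ext x
  simp only [mem_ofPred_eq, Sum.forall, Sum.elim_inl, Sum.elim_inr, LinearMap.neg_apply, Rat.cast_neg, neg_le_neg_iff,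
    forall_const, hq]
  refine and_congr_right fun _ => and_congr_left fun _ => ?_
  rw [← forall_and]
  exact forall_congr' fun i => le_antisymm_iff

theorem ratpoly_single {d : ℕ} {Λ : AddSubgroup (Vd d)} {k : ℕ} (E : Fin k → Vd d →ₗ[ℝ] ℝ) (p : Vd d)
    (hE : ∀ i, ∀ x ∈ Λ, ∃ n : ℤ, E i x = n)
    (hp : ∀ i, ∃ q : ℚ, E i p = q) (hps : p ∈ Submodule.span ℝ (Λ : Set (Vd d)))
    (hinj : ∀ x ∈ Submodule.span ℝ (Λ : Set (Vd d)), (∀ i, E i x = 0) → x = 0) :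
    IsRatPolyhedron Λ {p} := by
  have := ratpoly E p 0 0 hE hp (fun x _ => ⟨0, by simp⟩)
  convert this using 1
  ext x
  simp only [mem_singleton_iff, mem_ofPred_eq, LinearMap.zero_apply, Rat.cast_zero, le_refl, and_true]
  constructor
  · rintro rfl
    exact ⟨hps, fun _ => rfl⟩
  · rintro ⟨h1, h2⟩
    exact sub_eq_zero.mp (hinj _ (Submodule.sub_mem _ h1 hps) fun i => by rw [map_sub, h2, sub_self])

theorem I_single {d : ℕ} {Λ : AddSubgroup (Vd d)} {I : Set (Vd d) → Vd d → ℝ} (hI : IsIMap Λ I) {p : Vd d}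
    (hp : IsRatPolyhedron Λ {p}) (ξ : Vd d) : I {p} ξ = Real.exp (pairE ξ p) := by
  have hm : IsCanonicalMeasure Λ ((affineSpan ℝ {p} : AffineSubspace ℝ (Vd d)) : Set (Vd d))
      (Measure.dirac p) := by
    refine ⟨0, p, Fin.elim0, by simp, fun i => i.elim0, linearIndependent_empty_type, ?_, ?_, ?_⟩
    · ext x; simp
    · intro y _ hy
      refine ⟨0, ?_⟩
      simpa using hy
    · have he : (fun r : Fin 0 → ℝ => p + ∑ i, r i • (Fin.elim0 i : Vd d)) = fun _ => p := by
        funext r; simp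
      rw [Measure.volume_pi_eq_dirac (Fin.elim0), he, Measure.map_const]
      simp
  have hintg : Integrable (fun x => Real.exp (pairE ξ x)) (Measure.dirac p) :=
    integrable_dirac (by simp)
  rw [hI.2.2 {p} hp _ hm ξ hintg.integrableOn]
  rw [Measure.restrict_eq_self_of_ae_mem]
  · simp
  · rw [ae_dirac_eq]; simp

theorem S_single {d : ℕ} {Λ : AddSubgroup (Vd d)} {S : Set (Vd d) → Vd d → ℝ} (hS : IsSMap Λ S) {p : Vd d}
    (hp : IsRatPolyhedron Λ {p}) (hpΛ : p ∈ Λ) (ξ : Vd d) : S {p} ξ = Real.exp (pairE ξ p) := by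
  have he : ({p} : Set (Vd d)) ∩ (Λ : Set (Vd d)) = {p} := by
    ext x; simp only [mem_inter_iff, mem_singleton_iff, SetLike.mem_coe]
    exact ⟨fun h => h.1, fun h => ⟨h, h ▸ hpΛ⟩⟩
  have hs := hS.2.2 {p} hp ξ
  rw [he] at hs
  rw [hs (Summable.of_finite)]
  exact tsum_singleton p (fun x => Real.exp (pairE ξ x))

theorem suppCone_single {d : ℕ} (p : Vd d) : suppCone {p} {p} = {p} := by
  ext z
  simp only [suppCone, feasibleCone, intrinsicInterior_singleton, mem_ofPred_eq, mem_singleton_iff,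
    AffineSubspace.coe_affineSpan_singleton]
  constructor
  · rintro ⟨a, rfl, u, ⟨x, rfl, ε, hε, h⟩, rfl⟩
    have h1 := h ε hε le_rfl
    have h2 : ε • u = 0 := by simpa using h1
    rcases smul_eq_zero.mp h2 with h3 | h3
    · exact absurd h3 hε.ne'
    · simp [h3]
  · rintro rfl
    exact ⟨z, rfl, 0, ⟨z, rfl, 1, one_pos, by simp⟩, by simp⟩

theorem face_single {d : ℕ} (p : Vd d) (F : Set (Vd d)) : IsFaceOf {p} F ↔ F = {p} := by
  constructor
  · rintro ⟨⟨x, hx⟩, φ, rfl⟩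
    ext y
    simp only [mem_ofPred_eq, mem_singleton_iff, forall_eq]
    exact ⟨fun h => h.1, fun h => ⟨h, by rw [h]⟩⟩
  · rintro rfl
    refine ⟨⟨p, rfl⟩, 0, ?_⟩
    ext y
    simp only [mem_ofPred_eq, mem_singleton_iff, forall_eq]
    exact ⟨fun h => ⟨h, by rw [h]⟩, fun h => h.1⟩

theorem qcoproj_bot {d : ℕ} (Q : Vd d →ₗ[ℝ] Vd d →ₗ[ℝ] ℝ) : IsQCoproj Q ⊥ LinearMap.id := by
  refine ⟨fun x => by simp, fun x y hy => ?_⟩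
  rw [Submodule.mem_bot] at hy
  simp [hy]

theorem map_id_lat {d : ℕ} (Λ : AddSubgroup (Vd d)) :
    AddSubgroup.map (LinearMap.id : Vd d →ₗ[ℝ] Vd d).toAddMonoidHom Λ = Λ := by
  ext x
  simp [AddSubgroup.mem_map]

theorem mu_single {d : ℕ} {Λ Λ' : AddSubgroup (Vd d)} {Q : Vd d →ₗ[ℝ] Vd d →ₗ[ℝ] ℝ}
    {I S μ : AddSubgroup (Vd d) → Set (Vd d) → Vd d → ℝ}
    (hI : IsIFamily Q Λ I) (hS : IsSFamily Q Λ S) (hμ : IsMuFamily Λ Q I S μ)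
    (hΛ' : IsQuotLattice Q Λ Λ') {p : Vd d} (hp : IsRatPolyhedron Λ' {p}) (hpΛ : p ∈ Λ') :
    NearGen (fun ξ => μ Λ' {p} ξ = 1) := by
  have hcone : IsRatAffineCone Λ' {p} := by
    refine ⟨p, 0, Fin.elim0, ⟨1, one_ne_zero, by simpa using hpΛ⟩, fun i => i.elim0, ?_⟩
    ext x
    simp only [mem_singleton_iff, mem_ofPred_eq]
    exact ⟨fun h => ⟨0, by simp, by simp [h]⟩, fun ⟨_, _, h⟩ => by simpa using h⟩
  have hline : ¬ ContainsLine {p} := by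
    rintro ⟨x, u, hu, h⟩
    have h0 := h 0
    have h1 := h 1
    simp only [mem_singleton_iff, zero_smul, add_zero, one_smul] at h0 h1
    rw [h0] at h1
    exact hu (by simpa using h1)
  have h := hμ.1.2.2 Λ' hΛ' {p} hcone hline (fun _ => LinearMap.id) (by
    intro F hF
    rw [face_single] at hF
    subst hF
    rw [direction_affineSpan, vectorSpan_singleton]
    exact qcoproj_bot Q)
  have hset : {F | IsFaceOf {p} F} = {({p} : Set (Vd d))} := by
    ext F
    simp [face_single]
  rw [hset] at h
  obtain ⟨Z, z1, z2, z3⟩ := h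
  refine ⟨Z, z1, z2, ?_⟩
  filter_upwards [z3] with ξ hξ hnot
  have h2 := hξ hnot
  rw [finsum_mem_singleton, map_id_lat, suppCone_single, S_single (hS Λ' hΛ') hp hpΛ,
    I_single (hI Λ' hΛ') hp] at h2
  have h3 : (LinearMap.id : Vd d →ₗ[ℝ] Vd d) '' {p} = {p} := by simp
  rw [h3] at h2
  have := Real.exp_pos (pairE ξ p)
  exact mul_right_cancel₀ this.ne' (by rw [← h2, one_mul])

def ray {d : ℕ} (a₀ v : Vd d) (t : ℝ) : Set (Vd d) := {x | ∃ u : ℝ, -t ≤ u ∧ x = a₀ + u • v}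

section raysec

theorem ray_mem {d : ℕ} {a₀ v : Vd d} {t : ℝ} (hv : v ≠ 0) (u : ℝ) : a₀ + u • v ∈ ray a₀ v t ↔ -t ≤ u := by
  constructor
  · rintro ⟨w, hw, h⟩
    have : u • v = w • v := by simpa using h
    rw [smul_left_injective ℝ hv this]
    exact hw
  · intro h
    exact ⟨u, h, rfl⟩

theorem ray_affineSpan {d : ℕ} {a₀ v : Vd d} {t : ℝ} (ht : 0 ≤ t) :
    affineSpan ℝ (ray a₀ v t) = AffineSubspace.mk' a₀ (Submodule.span ℝ {v}) := by
  apply le_antisymm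
  · rw [affineSpan_le]
    rintro x ⟨u, hu, rfl⟩
    simp only [SetLike.mem_coe, AffineSubspace.mem_mk', vsub_eq_sub, add_sub_cancel_left]
    exact Submodule.smul_mem _ _ (Submodule.mem_span_singleton_self v)
  · intro x hx
    rw [AffineSubspace.mem_mk', vsub_eq_sub, Submodule.mem_span_singleton] at hx
    obtain ⟨r, hr⟩ := hx
    have h0 : a₀ ∈ affineSpan ℝ (ray a₀ v t) :=
      subset_affineSpan ℝ _ ⟨0, by linarith, by simp⟩
    have h1 : a₀ + v ∈ affineSpan ℝ (ray a₀ v t) :=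
      subset_affineSpan ℝ _ ⟨1, by linarith, by simp⟩
    have h2 := AffineMap.lineMap_mem r h0 h1
    rw [AffineMap.lineMap_apply] at h2
    have : x = a₀ + r • v := by rw [hr]; abel
    rw [this]
    simpa [add_comm] using h2

theorem ray_faces {d : ℕ} {a₀ v : Vd d} {t : ℝ} (hv : v ≠ 0) (F : Set (Vd d)) :
    IsFaceOf (ray a₀ v t) F ↔ F = {a₀ + (-t) • v} ∨ F = ray a₀ v t := by
  have key : ∀ φ : Vd d, pairE φ v < 0 →
      {x ∈ ray a₀ v t | ∀ y ∈ ray a₀ v t, pairE φ y ≤ pairE φ x} = {a₀ + (-t) • v} := by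
    intro φ hφ
    ext x
    simp only [mem_ofPred_eq, mem_singleton_iff]
    constructor
    · rintro ⟨⟨u, hu, rfl⟩, h⟩
      have := h (a₀ + (-t) • v) ⟨-t, le_rfl, rfl⟩
      rw [pairE_add, pairE_add, pairE_smul, pairE_smul] at this
      have : u = -t := by nlinarith
      rw [this]
    · rintro rfl
      refine ⟨⟨-t, le_rfl, rfl⟩, ?_⟩
      rintro y ⟨u, hu, rfl⟩
      rw [pairE_add, pairE_add, pairE_smul, pairE_smul]
      nlinarith
  have key0 : ∀ φ : Vd d, pairE φ v = 0 →
      {x ∈ ray a₀ v t | ∀ y ∈ ray a₀ v t, pairE φ y ≤ pairE φ x} = ray a₀ v t := by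
    intro φ hφ
    ext x
    simp only [mem_ofPred_eq, and_iff_left_iff_imp]
    rintro ⟨u, hu, rfl⟩ y ⟨u', hu', rfl⟩
    rw [pairE_add, pairE_add, pairE_smul, pairE_smul, hφ]
    simp
  constructor
  · rintro ⟨⟨x, hx⟩, φ, rfl⟩
    rcases lt_trichotomy (pairE φ v) 0 with h | h | h
    · exact Or.inl (key φ h)
    · exact Or.inr (key0 φ h)
    · exfalso
      obtain ⟨⟨u, hu, rfl⟩, h2⟩ := hx
      have := h2 (a₀ + (u + 1) • v) ⟨u + 1, by linarith, rfl⟩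
      rw [pairE_add, pairE_add, pairE_smul, pairE_smul] at this
      linarith
  · rintro (rfl | rfl)
    · refine ⟨⟨_, rfl⟩, (-1 : ℝ) • v, (key _ ?_).symm⟩
      rw [pairE_smul_left]
      linarith [pairE_self_pos hv]
    · refine ⟨⟨_, -t, le_rfl, rfl⟩, (0 : ℝ) • v, (key0 _ ?_).symm⟩
      rw [pairE_smul_left, zero_mul]

theorem ray_suppCone_vertex {d : ℕ} {a₀ v : Vd d} {t : ℝ} :
    suppCone (ray a₀ v t) {a₀ + (-t) • v} = ray a₀ v t := by
  ext z
  simp only [suppCone, feasibleCone, intrinsicInterior_singleton, mem_ofPred_eq, mem_singleton_iff,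
    AffineSubspace.coe_affineSpan_singleton]
  constructor
  · rintro ⟨a, rfl, u, ⟨x, rfl, ε, hε, h⟩, rfl⟩
    obtain ⟨w, hw, h1⟩ := h ε hε le_rfl
    have h2 : ε • u = (w + t) • v := by
      rw [add_assoc, add_right_inj] at h1
      rw [add_smul, ← h1, neg_smul]
      abel
    have h3 : u = (ε⁻¹ * (w + t)) • v := by
      rw [mul_smul, ← h2, smul_smul, inv_mul_cancel₀ hε.ne', one_smul]
    refine ⟨-t + ε⁻¹ * (w + t), ?_, ?_⟩
    · have : 0 ≤ ε⁻¹ * (w + t) := mul_nonneg (by positivity) (by linarith)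
      linarith
    · rw [h3, add_smul, add_assoc]
  · rintro ⟨u, hu, rfl⟩
    refine ⟨_, rfl, (u + t) • v, ⟨_, rfl, 1, one_pos, ?_⟩, ?_⟩
    · intro r hr _
      refine ⟨-t + r * (u + t), ?_, ?_⟩
      · have : 0 ≤ r * (u + t) := mul_nonneg hr.le (by linarith)
        linarith
      · module
    · rw [add_assoc, ← add_smul]
      congr 2
      ring

theorem ray_convex {d : ℕ} (a₀ v : Vd d) (t : ℝ) : Convex ℝ (ray a₀ v t) := by
  rintro x ⟨u, hu, rfl⟩ y ⟨w, hw, rfl⟩ α β hα hβ hab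
  refine ⟨α * u + β * w, ?_, ?_⟩
  · have e1 := mul_le_mul_of_nonneg_left hu hα
    have e2 := mul_le_mul_of_nonneg_left hw hβ
    have e3 : α * -t + β * -t = -t := by rw [← add_mul, hab, one_mul]
    linarith
  · have : α = 1 - β := by linarith
    subst this
    module

theorem ray_suppCone_self {d : ℕ} {a₀ v : Vd d} {t : ℝ} (ht : 0 ≤ t) (π : Vd d →ₗ[ℝ] Vd d)
    (hπ : π v = 0) : π '' suppCone (ray a₀ v t) (ray a₀ v t) = {π a₀} := by
  have hne : (ray a₀ v t).Nonempty := ⟨_, 0, by linarith, rfl⟩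
  obtain ⟨x₀, hx₀⟩ := hne.intrinsicInterior (ray_convex a₀ v t)
  have hx₀' : x₀ ∈ ray a₀ v t := intrinsicInterior_subset hx₀
  ext z
  constructor
  · rintro ⟨y, ⟨a, ha, u, ⟨x, hx, ε, hε, h⟩, rfl⟩, rfl⟩
    rw [ray_affineSpan ht, SetLike.mem_coe, AffineSubspace.mem_mk', vsub_eq_sub,
      Submodule.mem_span_singleton] at ha
    obtain ⟨r, hr⟩ := ha
    have ha' : a = a₀ + r • v := by rw [hr]; abel
    obtain ⟨w, -, hw⟩ := intrinsicInterior_subset hx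
    obtain ⟨w', -, hw'⟩ := h ε hε le_rfl
    have h1 : ε • u = (w' - w) • v := by
      rw [sub_smul]
      rw [hw, add_assoc, add_right_inj] at hw'
      rw [← hw']
      abel
    have h2 : ε • π u = 0 := by rw [← map_smul, h1, map_smul, hπ, smul_zero]
    have h3 : π u = 0 := (smul_eq_zero.mp h2).resolve_left hε.ne'
    rw [map_add, h3, ha', map_add, map_smul, hπ]
    simp
  · rintro rfl
    refine ⟨a₀, ⟨a₀, ?_, 0, ⟨x₀, hx₀, 1, one_pos, ?_⟩, by simp⟩, rfl⟩
    · exact subset_affineSpan ℝ _ ⟨0, by linarith, by simp⟩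
    · intro r _ _
      simpa using hx₀'

theorem ray_noline {d : ℕ} {a₀ v : Vd d} {t : ℝ} (hv : v ≠ 0) : ¬ ContainsLine (ray a₀ v t) := by
  rintro ⟨x, u, hu, h⟩
  obtain ⟨w, -, hw⟩ := h 0
  obtain ⟨w', -, hw'⟩ := h 1
  simp only [zero_smul, add_zero, one_smul] at hw hw'
  have huv : u = (w' - w) • v := by
    rw [hw, add_assoc, add_right_inj] at hw'
    rw [sub_smul, ← hw']
    abel
  have hc : w' - w ≠ 0 := by
    intro h0
    rw [h0, zero_smul] at huv
    exact hu huv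
  have h2 := h ((-t - 1 - w) / (w' - w))
  have h3 : x + ((-t - 1 - w) / (w' - w)) • u = a₀ + (-t - 1) • v := by
    rw [huv, smul_smul, div_mul_cancel₀ _ hc, hw]
    module
  rw [h3, ray_mem hv] at h2
  linarith

theorem ray_cone {d : ℕ} {Λ : AddSubgroup (Vd d)} {a₀ v : Vd d} (ha : a₀ ∈ Λ) (hvΛ : v ∈ Λ) (t : ℚ) :
    IsRatAffineCone Λ (ray a₀ v t) := by
  refine ⟨a₀ + (-(t : ℝ)) • v, 1, fun _ => v, ⟨t.den, by exact_mod_cast t.den_nz, ?_⟩, fun _ => hvΛ, ?_⟩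
  · have h1 : (((t.den : ℤ) : ℝ)) • (a₀ + (-(t : ℝ)) • v) = (t.den : ℤ) • a₀ - t.num • v := by
      rw [smul_add, smul_smul]
      have : (((t.den : ℤ) : ℝ)) * (-(t : ℝ)) = -((t.num : ℤ) : ℝ) := by
        have := Rat.den_mul_eq_num t
        rw [mul_neg]
        congr 1
        exact_mod_cast this
      rw [this, neg_smul, Int.cast_smul_eq_zsmul, Int.cast_smul_eq_zsmul, sub_eq_add_neg]
    rw [h1]
    exact Λ.sub_mem (Λ.zsmul_mem ha _) (Λ.zsmul_mem hvΛ _)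
  · ext x
    simp only [ray, mem_ofPred_eq, Finset.univ_unique, Finset.sum_singleton]
    constructor
    · rintro ⟨u, hu, rfl⟩
      refine ⟨fun _ => u + t, fun _ => by linarith, ?_⟩
      module
    · rintro ⟨r, hr, rfl⟩
      refine ⟨-t + r default, by linarith [hr default], ?_⟩
      module

theorem ray_S {d : ℕ} {Λ : AddSubgroup (Vd d)} {S : Set (Vd d) → Vd d → ℝ} (hS : IsSMap Λ S)
    {a₀ v : Vd d} {t : ℝ} (ha : a₀ ∈ Λ) (hvΛ : v ∈ Λ) (hv : v ≠ 0)
    (hprim : ∀ x ∈ Λ, (∃ r : ℝ, x = r • v) → ∃ n : ℤ, x = (n : ℝ) • v)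
    (ht0 : 0 ≤ t) (ht1 : t < 1) (hP : IsRatPolyhedron Λ (ray a₀ v t)) (ξ : Vd d) (hξ : pairE ξ v < 0) :
    S (ray a₀ v t) ξ * (1 - Real.exp (pairE ξ v)) = Real.exp (pairE ξ a₀) := by
  have hset : ray a₀ v t ∩ (Λ : Set (Vd d)) = Set.range (fun n : ℕ => a₀ + (n : ℝ) • v) := by
    ext x
    constructor
    · rintro ⟨⟨u, hu, rfl⟩, hx⟩
      have h1 : u • v ∈ Λ := by
        have := Λ.sub_mem hx ha
        simpa using this
      obtain ⟨n, hn⟩ := hprim _ h1 ⟨u, rfl⟩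
      have hun : u = n := smul_left_injective ℝ hv hn
      have : (-1 : ℝ) < n := by rw [← hun]; linarith
      have h2 : (-1 : ℤ) < n := by exact_mod_cast this
      obtain ⟨m, rfl⟩ := Int.eq_ofNat_of_zero_le (by omega : 0 ≤ n)
      exact ⟨m, by simp [hun]⟩
    · rintro ⟨n, rfl⟩
      refine ⟨⟨n, by linarith [(Nat.cast_nonneg n : (0 : ℝ) ≤ n)], rfl⟩, ?_⟩
      refine Λ.add_mem ha ?_
      rw [Nat.cast_smul_eq_nsmul]
      exact Λ.nsmul_mem hvΛ n
  have hinj : Function.Injective (fun n : ℕ => a₀ + (n : ℝ) • v) := by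
    intro m n h
    have : (m : ℝ) • v = (n : ℝ) • v := by simpa using h
    exact_mod_cast smul_left_injective ℝ hv this
  have hlt : Real.exp (pairE ξ v) < 1 := Real.exp_lt_one_iff.mpr hξ
  have hgeo := (hasSum_geometric_of_lt_one (Real.exp_pos (pairE ξ v)).le hlt).mul_left (Real.exp (pairE ξ a₀))
  have hs : HasSum (fun x : ↥(ray a₀ v t ∩ (Λ : Set (Vd d))) => Real.exp (pairE ξ (x : Vd d)))
      (Real.exp (pairE ξ a₀) * (1 - Real.exp (pairE ξ v))⁻¹) := by
    rw [hset]
    refine (hinj.hasSum_range_iff (f := fun x => Real.exp (pairE ξ x))).mpr ?_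
    refine HasSum.congr_fun_val hgeo (fun n => ?_) rfl
    simp only [Function.comp, pairE_add, pairE_smul, Real.exp_add, ← Real.exp_nat_mul]
  rw [hS.2.2 _ hP ξ hs.summable, hs.tsum_eq]
  have : 1 - Real.exp (pairE ξ v) ≠ 0 := by linarith
  field_simp

theorem ray_I {d : ℕ} {Λ : AddSubgroup (Vd d)} {I : Set (Vd d) → Vd d → ℝ} (hI : IsIMap Λ I)
    {a₀ v : Vd d} {t : ℝ} (hvΛ : v ∈ Λ) (hv : v ≠ 0)
    (hprim : ∀ x ∈ Λ, (∃ r : ℝ, x = r • v) → ∃ n : ℤ, x = (n : ℝ) • v)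
    (ht0 : 0 ≤ t) (hP : IsRatPolyhedron Λ (ray a₀ v t)) (ξ : Vd d) (hξ : pairE ξ v < 0) :
    I (ray a₀ v t) ξ * pairE ξ v = - Real.exp (pairE ξ (a₀ + (-t) • v)) := by
  have hemb : MeasurableEmbedding (fun u : ℝ => a₀ + u • v) :=
    ((Homeomorph.addLeft a₀).isClosedEmbedding.comp (isClosedEmbedding_smul_left hv)).measurableEmbedding
  have hm : IsCanonicalMeasure Λ ((affineSpan ℝ (ray a₀ v t) : AffineSubspace ℝ (Vd d)) : Set (Vd d))
      (Measure.map (fun u : ℝ => a₀ + u • v) volume) := by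
    refine ⟨1, a₀, fun _ => v, ?_, fun _ => hvΛ, ?_, ?_, ?_, ?_⟩
    · exact subset_affineSpan ℝ _ ⟨0, by linarith, by simp⟩
    · exact LinearIndependent.of_subsingleton 0 hv
    · rw [ray_affineSpan ht0]
      ext x
      simp only [SetLike.mem_coe, AffineSubspace.mem_mk', vsub_eq_sub, Submodule.mem_span_singleton,
        mem_ofPred_eq, Finset.univ_unique, Finset.sum_singleton]
      constructor
      · rintro ⟨r, hr⟩
        exact ⟨fun _ => r, by rw [hr]; abel⟩
      · rintro ⟨r, rfl⟩
        exact ⟨r default, by abel⟩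
    · intro y hy hys
      rw [Set.range_const, Submodule.mem_span_singleton] at hys
      obtain ⟨r, hr⟩ := hys
      obtain ⟨n, hn⟩ := hprim y hy ⟨r, hr.symm⟩
      exact ⟨fun _ => n, by simp [hn]⟩
    · have hmp := (MeasureTheory.volume_preserving_funUnique (Fin 1) ℝ)
      rw [← hmp.map_eq, Measure.map_map hemb.measurable hmp.measurable]
      congr 1
      funext r
      simp
  have hpre : (fun u : ℝ => a₀ + u • v) ⁻¹' (ray a₀ v t) = Set.Ici (-t) := by
    ext u
    exact ray_mem hv u
  have hcomp : ∀ u : ℝ, Real.exp (pairE ξ (a₀ + u • v)) = Real.exp (pairE ξ a₀) * Real.exp (pairE ξ v * u) := by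
    intro u
    rw [pairE_add, pairE_smul, Real.exp_add, mul_comm u]
  have hintg : IntegrableOn (fun x => Real.exp (pairE ξ x)) (ray a₀ v t)
      (Measure.map (fun u : ℝ => a₀ + u • v) volume) := by
    rw [hemb.integrableOn_map_iff, hpre, integrableOn_Ici_iff_integrableOn_Ioi]
    have := (integrableOn_exp_mul_Ioi hξ (-t)).const_mul (Real.exp (pairE ξ a₀))
    refine this.congr (Eventually.of_forall fun u => ?_)
    simp only [Function.comp, hcomp]
  rw [hI.2.2 _ hP _ hm ξ hintg, hemb.setIntegral_map, hpre]
  simp only [hcomp]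
  rw [MeasureTheory.integral_Ici_eq_integral_Ioi, integral_const_mul, integral_exp_mul_Ioi hξ]
  have := hξ.ne
  field_simp

end raysec

theorem part2 (d : ℕ) (Λ : AddSubgroup (Vd d)) (hΛ : IsFullLattice Λ)
      (Q : Vd d →ₗ[ℝ] Vd d →ₗ[ℝ] ℝ) (hQ : IsRatInner Λ Q)
      (I S μ : AddSubgroup (Vd d) → Set (Vd d) → Vd d → ℝ)
      (hI : IsIFamily Q Λ I) (hS : IsSFamily Q Λ S) (hμ : IsMuFamily Λ Q I S μ)
      (a₀ v : Vd d) (ha : a₀ ∈ Λ) (hvΛ : v ∈ Λ) (hv : v ≠ 0)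
      (hprim : ∀ x ∈ Λ, (∃ r : ℝ, x = r • v) → ∃ n : ℤ, x = (n : ℝ) • v)
      (t : ℚ) (ht0 : 0 ≤ t) (ht1 : t < 1) :
        MeroEqAt0 (μ Λ (ray a₀ v t))
          (fun ξ => Real.exp ((t : ℝ) * pairE ξ v) / (1 - Real.exp (pairE ξ v)) +
            1 / pairE ξ v) := by
  have ht0' : (0 : ℝ) ≤ t := by exact_mod_cast ht0
  have ht1' : (t : ℝ) < 1 := by exact_mod_cast ht1
  obtain ⟨k, l, hl, hlinj⟩ := lat_coords hΛ
  choose n hn using fun i => hl i v hvΛ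
  choose m hm using fun i => hl i a₀ ha
  obtain ⟨j, hj⟩ : ∃ j, n j ≠ 0 := by
    by_contra hcon
    push Not at hcon
    exact hv (hlinj v fun i => by rw [hn, hcon]; simp)
  have hj' : (n j : ℝ) ≠ 0 := by exact_mod_cast hj
  let E : Fin k → Vd d →ₗ[ℝ] ℝ := fun i => (n j : ℝ) • l i - (n i : ℝ) • l j
  have hEap : ∀ i x, E i x = (n j : ℝ) * l i x - (n i : ℝ) * l j x := fun i x => rfl
  have hE : ∀ i, ∀ x ∈ Λ, ∃ q : ℤ, E i x = q := by
    intro i x hx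
    obtain ⟨p, hp⟩ := hl i x hx
    obtain ⟨q, hq⟩ := hl j x hx
    exact ⟨n j * p - n i * q, by rw [hEap, hp, hq]; push_cast; ring⟩
  have hEv : ∀ i, E i v = 0 := by
    intro i
    rw [hEap, hn, hn]
    ring
  have hEker : ∀ x, (∀ i, E i x = 0) → x = (l j x / n j) • v := by
    intro x hx
    rw [← sub_eq_zero]
    apply hlinj
    intro i
    have := hx i
    rw [hEap] at this
    rw [map_sub, map_smul, hn, smul_eq_mul]
    field_simp
    linarith
  have hspan : ∀ x, x ∈ Submodule.span ℝ (Λ : Set (Vd d)) := by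
    intro x
    rw [hΛ.2]
    trivial
  have hPray : IsRatPolyhedron Λ (ray a₀ v t) := by
    have := ratpoly (Λ := Λ) E a₀ ((-(n j : ℝ)) • l j) (-n j * m j + t * n j ^ 2) hE
      (fun i => by obtain ⟨q, hq⟩ := hE i a₀ ha; exact ⟨q, by rw [hq]; push_cast; ring⟩)
      (fun x hx => by
        obtain ⟨q, hq⟩ := hl j x hx
        exact ⟨-n j * q, by simp [hq]⟩)
    convert this using 1
    ext x
    simp only [mem_ofPred_eq, hspan, true_and, LinearMap.smul_apply, smul_eq_mul]
    push_cast
    have hsq : 0 < (n j : ℝ) ^ 2 := by positivity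
    constructor
    · rintro ⟨u, hu, rfl⟩
      refine ⟨fun i => by rw [map_add, map_smul, hEv]; simp, ?_⟩
      rw [map_add, map_smul, hm, hn, smul_eq_mul]
      nlinarith
    · rintro ⟨h1, h2⟩
      have h3 := hEker (x - a₀) fun i => by rw [map_sub, h1, sub_self]
      refine ⟨l j (x - a₀) / n j, ?_, by rw [← h3]; abel⟩
      have h4 : l j x = m j + (l j (x - a₀) / n j) * n j := by
        rw [div_mul_cancel₀ _ hj', map_sub, hm]; ring
      rw [h4] at h2
      nlinarith
  have hPs : IsRatPolyhedron Λ {a₀ + (-(t : ℝ)) • v} := by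
    refine ratpoly_single l _ hl (fun i => ⟨m i - t * n i, ?_⟩) (hspan _) (fun x _ => hlinj x)
    rw [map_add, map_smul, hm, hn, smul_eq_mul]
    push_cast
    ring
  have hQv : 0 < Q v v := hQ.2.1 v hv
  let pr : Vd d →ₗ[ℝ] Vd d := LinearMap.id - ((Q v v)⁻¹ • Q v).smulRight v
  have hpr : ∀ x, pr x = x - ((Q v v)⁻¹ * Q v x) • v := fun x => rfl
  have hprv : pr v = 0 := by
    rw [hpr, inv_mul_cancel₀ hQv.ne', one_smul, sub_self]
  have hQpr : ∀ x, Q v (pr x) = 0 := by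
    intro x
    rw [hpr, map_sub, map_smul, smul_eq_mul]
    field_simp
    ring
  have hEpr : ∀ i x, E i (pr x) = E i x := by
    intro i x
    rw [hpr, map_sub, map_smul, hEv]
    simp
  have hcopr : IsQCoproj Q (Submodule.span ℝ {v}) pr := by
    refine ⟨fun x => ?_, fun x y hy => ?_⟩
    · rw [hpr, sub_sub_cancel]
      exact Submodule.smul_mem _ _ (Submodule.mem_span_singleton_self v)
    · obtain ⟨r, rfl⟩ := Submodule.mem_span_singleton.mp hy
      rw [map_smul, hQ.1, hQpr, smul_zero]
  set Λ' := AddSubgroup.map pr.toAddMonoidHom Λ with hΛ'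
  have hquot : IsQuotLattice Q Λ Λ' := by
    refine ⟨Submodule.span ℝ {v}, pr, ?_, hcopr, rfl⟩
    apply le_antisymm
    · rw [Submodule.span_le]
      exact fun x hx => hx.1
    · rw [Submodule.span_le]
      rintro x rfl
      exact Submodule.subset_span ⟨Submodule.mem_span_singleton_self _, hvΛ⟩
  have hquot0 : IsQuotLattice Q Λ Λ := by
    refine ⟨⊥, LinearMap.id, ?_, qcoproj_bot Q, (map_id_lat Λ).symm⟩
    rw [Submodule.span_eq_bot]
    rintro x ⟨hx, _⟩
    exact hx
  have hpa : pr a₀ ∈ Λ' := ⟨a₀, ha, rfl⟩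
  have hPp : IsRatPolyhedron Λ' {pr a₀} := by
    refine ratpoly_single E _ ?_ (fun i => ?_) (Submodule.subset_span hpa) ?_
    · rintro i _ ⟨x, hx, rfl⟩
      obtain ⟨q, hq⟩ := hE i x hx
      exact ⟨q, by rw [← hq]; exact hEpr i x⟩
    · obtain ⟨q, hq⟩ := hE i a₀ ha
      exact ⟨q, by rw [hEpr, hq]; push_cast; ring⟩
    · intro x hx hx0
      have h1 : Submodule.span ℝ (Λ' : Set (Vd d)) ≤ LinearMap.ker (Q v) := by
        rw [Submodule.span_le]
        rintro _ ⟨y, hy, rfl⟩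
        exact hQpr y
      have h2 : Q v x = 0 := h1 hx
      have h3 := hEker x hx0
      rw [h3, map_smul, smul_eq_mul] at h2
      have h4 := (mul_eq_zero.mp h2).resolve_right hQv.ne'
      rw [h3, h4, zero_smul]
  have hmu1 := mu_single hI hS hμ hquot hPp hpa
  have hexpan : ∀ x : Vd d, AnalyticOnNhd ℝ (fun ξ : Vd d => Real.exp (pairE ξ x)) univ := by
    intro x ξ hξ
    exact (pairE_analytic x ξ hξ).rexp
  have hSr := mero_ext hv ((hS Λ hquot0).1 _ hPray) (hexpan a₀)
    (analyticOnNhd_const.sub (hexpan v))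
    (ray_S (hS Λ hquot0) ha hvΛ hv hprim ht0' ht1' hPray)
  have hIr := mero_ext hv ((hI Λ hquot0).1 _ hPray) (hexpan (a₀ + (-(t : ℝ)) • v)).neg
    (pairE_analytic v)
    (ray_I (hI Λ hquot0) hvΛ hv hprim ht0' hPray)
  have hne : ({a₀ + (-(t : ℝ)) • v} : Set (Vd d)) ≠ ray a₀ v t := by
    intro h
    have h1 : a₀ + (1 : ℝ) • v ∈ ray a₀ v t := ⟨1, by linarith, rfl⟩
    rw [← h, mem_singleton_iff, add_right_inj] at h1
    have : (1 : ℝ) = -t := smul_left_injective ℝ hv h1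
    linarith
  classical
  let π : Set (Vd d) → (Vd d →ₗ[ℝ] Vd d) := fun F => if F = ray a₀ v t then pr else LinearMap.id
  have hπ1 : π (ray a₀ v t) = pr := if_pos rfl
  have hπ2 : π {a₀ + (-(t : ℝ)) • v} = LinearMap.id := if_neg hne
  have hrel := hμ.1.2.2 Λ hquot0 (ray a₀ v t) (ray_cone ha hvΛ t) (ray_noline hv) π (by
    intro F hF
    rcases (ray_faces hv F).mp hF with rfl | rfl
    · rw [direction_affineSpan, vectorSpan_singleton, hπ2]
      exact qcoproj_bot Q
    · rw [ray_affineSpan ht0', AffineSubspace.direction_mk', hπ1]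
      exact hcopr)
  have hset : {F | IsFaceOf (ray a₀ v t) F} = {{a₀ + (-(t : ℝ)) • v}, ray a₀ v t} := by
    ext F
    simp [ray_faces hv]
  rw [hset] at hrel
  have hrel2 : NearGen (fun ξ => S Λ (ray a₀ v t) ξ =
      μ Λ (ray a₀ v t) ξ * Real.exp (pairE ξ (a₀ + (-(t : ℝ)) • v)) +
        μ Λ' {pr a₀} ξ * I Λ (ray a₀ v t) ξ) := by
    obtain ⟨Z, z1, z2, z3⟩ := hrel
    refine ⟨Z, z1, z2, ?_⟩
    filter_upwards [z3] with ξ hξ hnot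
    rw [hξ hnot, finsum_mem_pair hne, hπ1, hπ2, map_id_lat, ray_suppCone_vertex,
      ray_suppCone_self ht0' pr hprv, I_single (hI Λ hquot0) hPs, LinearMap.id_coe, image_id]
  have hfin : NearGen (fun ξ => μ Λ (ray a₀ v t) ξ =
      Real.exp ((t : ℝ) * pairE ξ v) / (1 - Real.exp (pairE ξ v)) + 1 / pairE ξ v) := by
    refine (hSr.mp2 hIr (R := fun ξ => _ ∧ _) fun ξ h1 h2 => ⟨h1, h2⟩).mp2
      ((hrel2.mp2 hmu1 (R := fun ξ => _ ∧ _) fun ξ h1 h2 => ⟨h1, h2⟩).mp2 (nearGen_line hv)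
        (R := fun ξ => _ ∧ _) fun ξ h1 h2 => ⟨h1, h2⟩) ?_
    rintro ξ ⟨h1, h2⟩ ⟨⟨h3, h4⟩, h5⟩
    rw [h4, one_mul] at h3
    have h2' : I Λ (ray a₀ v t) ξ * pairE ξ v = - Real.exp (pairE ξ (a₀ + (-(t : ℝ)) • v)) := h2
    have hy : 1 - Real.exp (pairE ξ v) ≠ 0 := by
      intro h
      apply h5
      rw [← Real.exp_eq_one_iff]
      linarith
    have hes : Real.exp (pairE ξ a₀) =
        Real.exp (pairE ξ (a₀ + (-(t : ℝ)) • v)) * Real.exp (t * pairE ξ v) := by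
      rw [← Real.exp_add, pairE_add, pairE_smul]
      congr 1
      ring
    have hepos := Real.exp_pos (pairE ξ (a₀ + (-(t : ℝ)) • v))
    replace h1 : S Λ (ray a₀ v t) ξ * (1 - Real.exp (pairE ξ v)) = Real.exp (pairE ξ a₀) := h1
    rw [← eq_div_iff hy, hes] at h1
    rw [← eq_div_iff h5] at h2'
    rw [h1, h2'] at h3
    apply mul_right_cancel₀ hepos.ne'
    rw [eq_sub_of_add_eq h3.symm]
    ring
  exact hfin

/-- in dimension one (and in general for a rational half-line `a` containing
integral points, written `a = a₀ + (−t + ℝ₊)v` with `a₀` integral, `v` primitive integral and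
`t ∈ [0,1)`), one has `μ(a)(ξ) = e^{t⟨ξ,v⟩}/(1−e^{⟨ξ,v⟩}) + 1/⟨ξ,v⟩`; moreover the Taylor
expansion of `y ↦ e^{ty}/(1−e^y) + 1/y` at `0` is `−∑_{n≥0} b(n+1,t)/(n+1)! · yⁿ` where
`b(n,t)` are the Bernoulli polynomials. -/
theorem statement7 :
    (∀ t : ℚ, 0 ≤ t → t < 1 →
      ∀ᶠ y in nhdsWithin (0 : ℝ) {y : ℝ | y ≠ 0},
        HasSum
          (fun n : ℕ =>
            ((-(Polynomial.eval t (Polynomial.bernoulli (n + 1)) /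
                (Nat.factorial (n + 1) : ℚ)) : ℚ) : ℝ) * y ^ n)
          (Real.exp ((t : ℝ) * y) / (1 - Real.exp y) + 1 / y)) ∧
    (∀ (d : ℕ) (Λ : AddSubgroup (Vd d)), IsFullLattice Λ →
      ∀ (Q : Vd d →ₗ[ℝ] Vd d →ₗ[ℝ] ℝ), IsRatInner Λ Q →
      ∀ (I S μ : AddSubgroup (Vd d) → Set (Vd d) → Vd d → ℝ),
        IsIFamily Q Λ I → IsSFamily Q Λ S → IsMuFamily Λ Q I S μ →
      ∀ (a₀ v : Vd d), a₀ ∈ Λ → v ∈ Λ → v ≠ 0 →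
        (∀ x ∈ Λ, (∃ r : ℝ, x = r • v) → ∃ n : ℤ, x = (n : ℝ) • v) →
      ∀ t : ℚ, 0 ≤ t → t < 1 →
        MeroEqAt0 (μ Λ {x | ∃ u : ℝ, -(t : ℝ) ≤ u ∧ x = a₀ + u • v})
          (fun ξ => Real.exp ((t : ℝ) * pairE ξ v) / (1 - Real.exp (pairE ξ v)) +
            1 / pairE ξ v)) := by
  exact ⟨part1, fun d Λ hΛ Q hQ I S μ hI hS hμ a₀ v ha hvΛ hv hprim t ht0 ht1 =>
    part2 d Λ hΛ Q hQ I S μ hI hS hμ a₀ v ha hvΛ hv hprim t ht0 ht1⟩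
end
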